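/- Let α > 0 and let g : ℝ² → ℂ be a Schwartz function. For j ∈ ℤ define W_j : ℝ² → ℂ by W_j(x₁,x₂) := −∫_ℝ e^{2πix₂ξ}·φ_j(ξ)·(α² + 16π²ξ²)^(−1/2)·(2πiξ)·( ∫_{−∞}^{x₁} e^{λ₋(α,2πξ)(x₁−y)} ĝ(y,ξ) dy + ∫_{x₁}^{∞} e^{λ₊(α,2πξ)(x₁−y)} ĝ(y,ξ) dy ) dξ (all integrals converge absolutely); this is the block Δ_j of the operator 𝒟^{(0)} applied to ∂_{x₂}g. Then there exists a constant C > 0, independent of α, g, j and the exponents, such that for all p₁, p₂, p₃ ∈ [1,∞] with p₃ ≤ p₁: if 2^j > α then ‖W_j‖_{L^{p₁}L^{p₂}} ≤ C·2^{(−1+1/p₃−1/p₁)j}·‖Δ_j g‖_{L^{p₃}L^{p₂}}, and if 2^j ≤ α then ‖W_j‖_{L^{p₁}L^{p₂}} ≤ C·α^{1/p₁−1/p₃}·2^{(−1+2/p₃−2/p₁)j}·‖Δ_j g‖_{L^{p₃}L^{p₂}} (with 1/∞ := 0). -/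

import Mathlib

open MeasureTheory Real Complex
open scoped FourierTransform ENNReal SchwartzMap

noncomputable section

/-- `λ₊(α,ξ) = (α + √(α² + 4ξ²))/2`. -/
def lamP (α ξ : ℝ) : ℝ := (α + Real.sqrt (α ^ 2 + 4 * ξ ^ 2)) / 2

/-- `λ₋(α,ξ) = (α − √(α² + 4ξ²))/2`. -/
def lamM (α ξ : ℝ) : ℝ := (α - Real.sqrt (α ^ 2 + 4 * ξ ^ 2)) / 2

/-- Partial Fourier transform in the second variable:
`ĝ(y,ξ) = ∫ e^{-2πi x₂ ξ} g(y,x₂) dx₂`. -/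
def pFT (g : ℝ × ℝ → ℂ) (y ξ : ℝ) : ℂ := 𝓕 (fun x₂ : ℝ => g (y, x₂)) ξ

/-- Littlewood–Paley block in the second variable:
`Δ_j g(x₁,x₂) = ∫ e^{2πi x₂ ξ} φ_j(ξ) ĝ(x₁,ξ) dξ`. -/
def LPblock (φ₀ : ℝ → ℝ) (j : ℤ) (g : ℝ × ℝ → ℂ) (x₁ x₂ : ℝ) : ℂ :=
  𝓕⁻ (fun ξ : ℝ => (φ₀ ((2:ℝ) ^ (-j) * ξ) : ℂ) * pFT g x₁ ξ) x₂

/-- Mixed norm `L^{p₁}_{x₁} L^{p₂}_{x₂}` of `h : ℝ → ℝ → ℂ`. -/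
def mixedNorm (p₁ p₂ : ℝ≥0∞) (h : ℝ → ℝ → ℂ) : ℝ≥0∞ :=
  if p₁ = ∞ then essSup (fun x₁ : ℝ => eLpNorm (h x₁) p₂ volume) volume
  else (∫⁻ x₁ : ℝ, (eLpNorm (h x₁) p₂ volume) ^ p₁.toReal) ^ (1 / p₁.toReal)

/-- The block `Δ_j` of `𝒟^{(0)}[∂_{x₂}g]`. -/
def Wop (φ₀ : ℝ → ℝ) (α : ℝ) (j : ℤ) (g : ℝ × ℝ → ℂ) (x₁ x₂ : ℝ) : ℂ :=
  -𝓕⁻ (fun ξ : ℝ =>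
      (φ₀ ((2:ℝ) ^ (-j) * ξ) : ℂ) *
        (((α ^ 2 + 16 * π ^ 2 * ξ ^ 2) ^ (-(1:ℝ)/2) : ℝ) : ℂ) *
        (2 * (π : ℂ) * Complex.I * (ξ : ℂ)) *
        ((∫ y in Set.Iic x₁, (Real.exp (lamM α (2 * π * ξ) * (x₁ - y)) : ℂ) * pFT g y ξ) +
          ∫ y in Set.Ici x₁, (Real.exp (lamP α (2 * π * ξ) * (x₁ - y)) : ℂ) * pFT g y ξ)) x₂

/-- **Minkowski's integral inequality** in `ℝ≥0∞`, for real exponents. -/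
theorem lintegral_lintegral_rpow_le {X Y : Type*} [MeasurableSpace X] [MeasurableSpace Y]
    (μ : Measure Y) (ν : Measure X) [SFinite μ] [SigmaFinite ν] {p : ℝ} (hp : 1 ≤ p)
    {F : Y → X → ℝ≥0∞} (hF : Measurable (Function.uncurry F)) :
    ∫⁻ x, (∫⁻ y, F y x ∂μ) ^ p ∂ν ≤ (∫⁻ y, (∫⁻ x, F y x ^ p ∂ν) ^ (1 / p) ∂μ) ^ p := by
  rcases hp.eq_or_lt with rfl | hp1
  · simp only [ENNReal.rpow_one, div_one]
    exact (lintegral_lintegral_swap hF.aemeasurable).ge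
  have hp0 : 0 < p := by linarith
  have hpq := Real.HolderConjugate.conjExponent hp1
  set q := Real.conjExponent p
  set A := ∫⁻ y, (∫⁻ x, F y x ^ p ∂ν) ^ (1 / p) ∂μ
  set I : X → ℝ≥0∞ := fun x => ∫⁻ y, F y x ∂μ
  have hFs : Measurable (Function.uncurry fun x y => F y x) := hF.comp measurable_swap
  have hI : Measurable I := hFs.lintegral_prod_right
  let J : ℕ → X → ℝ≥0∞ := fun n => (spanningSets ν n).indicator fun x => min (I x) n
  have hJm : ∀ n, Measurable (J n) := fun n =>
    (hI.min measurable_const).indicator (measurableSet_spanningSets ν n)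
  have hJI : ∀ n x, J n x ≤ I x := fun n x =>
    (Set.indicator_le_self' (fun _ _ => zero_le) x).trans (min_le_left _ _)
  have hJn : ∀ n x, J n x ≤ (spanningSets ν n).indicator (fun _ => (n : ℝ≥0∞)) x := fun n x =>
    Set.indicator_le_indicator (min_le_right _ _)
  have hmono : Monotone J := by
    intro m n hmn x
    refine (Set.indicator_le_indicator_of_subset (monotone_spanningSets ν hmn)
      (fun _ => zero_le) x).trans (Set.indicator_le_indicator ?_)
    exact min_le_min le_rfl (by exact_mod_cast hmn)
  have hsup : ∀ x, ⨆ n, J n x = I x := by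
    intro x
    refine le_antisymm (iSup_le fun n => hJI n x) ?_
    refine le_of_forall_lt fun c hc => ?_
    obtain ⟨m, hm⟩ := ENNReal.exists_nat_gt hc.ne_top
    have hx : x ∈ ⋃ n, spanningSets ν n := by simp [iUnion_spanningSets]
    obtain ⟨n, hn⟩ := Set.mem_iUnion.1 hx
    refine lt_of_lt_of_le ?_ (le_iSup (fun n => J n x) (max m n))
    have : x ∈ spanningSets ν (max m n) := monotone_spanningSets ν (le_max_right m n) hn
    simp only [J, Set.indicator_of_mem this, lt_min_iff]
    refine ⟨hc, hm.trans_le ?_⟩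
    exact_mod_cast le_max_left m n
  have hbound : ∀ n, ∫⁻ x, J n x ^ p ∂ν ≤ A ^ p := by
    intro n
    set B := ∫⁻ x, J n x ^ p ∂ν
    have hBtop : B ≠ ∞ := by
      refine ne_top_of_le_ne_top ?_ (lintegral_mono fun x =>
        ENNReal.rpow_le_rpow (hJn n x) hp0.le)
      have : ∀ x, (spanningSets ν n).indicator (fun _ => (n : ℝ≥0∞)) x ^ p
          = (spanningSets ν n).indicator (fun _ => (n : ℝ≥0∞) ^ p) x := by
        intro x
        by_cases hx : x ∈ spanningSets ν n <;> simp [hx, hp0]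
      simp_rw [this]
      rw [lintegral_indicator_const (measurableSet_spanningSets ν n)]
      exact ENNReal.mul_ne_top (ENNReal.rpow_ne_top_of_nonneg hp0.le (ENNReal.natCast_ne_top n))
        (measure_spanningSets_lt_top ν n).ne
    have key : B ≤ A * B ^ (1 / q) := by
      calc B ≤ ∫⁻ x, I x * J n x ^ (p - 1) ∂ν := by
            refine lintegral_mono fun x => ?_
            calc J n x ^ p = J n x * J n x ^ (p - 1) := by
                  conv_rhs => rw [← ENNReal.rpow_one (J n x), ← ENNReal.rpow_mul, one_mul,
                    ← ENNReal.rpow_add_of_nonneg _ _ zero_le_one (by linarith)]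
                  congr 1; ring
              _ ≤ _ := by gcongr; exact hJI n x
        _ = ∫⁻ x, ∫⁻ y, F y x * J n x ^ (p - 1) ∂μ ∂ν := by
            refine lintegral_congr fun x => ?_
            rw [lintegral_mul_const]
            exact hF.comp (measurable_id.prodMk measurable_const)
        _ = ∫⁻ y, ∫⁻ x, F y x * J n x ^ (p - 1) ∂ν ∂μ := by
            refine lintegral_lintegral_swap (Measurable.aemeasurable ?_)
            exact hFs.mul (((hJm n).comp measurable_fst).pow_const _)
        _ ≤ ∫⁻ y, (∫⁻ x, F y x ^ p ∂ν) ^ (1 / p) * B ^ (1 / q) ∂μ := by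
            refine lintegral_mono fun y => ?_
            have hFy : Measurable (F y) := hF.comp (measurable_const.prodMk measurable_id)
            have := ENNReal.lintegral_mul_le_Lp_mul_Lq ν hpq hFy.aemeasurable
              ((hJm n).pow_const (p - 1)).aemeasurable
            refine this.trans_eq ?_
            congr 2
            refine lintegral_congr fun x => ?_
            rw [← ENNReal.rpow_mul, hpq.sub_one_mul_conj]
        _ = A * B ^ (1 / q) := by
            rw [lintegral_mul_const]
            refine Measurable.pow_const ?_ _
            exact (hF.pow_const p).lintegral_prod_right
    rcases eq_or_ne B 0 with h0 | h0
    · rw [h0]; exact zero_le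
    have hBq : B ^ (1 / q) ≠ 0 := by
      simp [ENNReal.rpow_eq_zero_iff, h0, hBtop]
    have hBq' : B ^ (1 / q) ≠ ∞ := ENNReal.rpow_ne_top_of_nonneg (by
      have := hpq.symm.pos; positivity) hBtop
    have h1 : B ^ (1 / p) ≤ A := by
      rw [← ENNReal.mul_le_mul_iff_left hBq hBq']
      refine le_trans (le_of_eq ?_) key
      rw [← ENNReal.rpow_add _ _ h0 hBtop]
      have := hpq.inv_add_inv_eq_one
      rw [one_div, one_div, this, ENNReal.rpow_one]
    calc B = (B ^ (1 / p)) ^ p := by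
          rw [← ENNReal.rpow_mul, one_div_mul_cancel hp0.ne', ENNReal.rpow_one]
      _ ≤ _ := ENNReal.rpow_le_rpow h1 hp0.le
  calc ∫⁻ x, I x ^ p ∂ν = ∫⁻ x, ⨆ n, J n x ^ p ∂ν := by
        refine lintegral_congr fun x => ?_
        rw [← hsup x]
        exact (ENNReal.orderIsoRpow p hp0).map_iSup _
    _ = ⨆ n, ∫⁻ x, J n x ^ p ∂ν :=
        lintegral_iSup (fun n => (hJm n).pow_const p)
          fun m n hmn x => ENNReal.rpow_le_rpow (hmono hmn x) hp0.le
    _ ≤ A ^ p := iSup_le hbound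

/-- **Minkowski's integral inequality** for `eLpNorm`, finite exponents. -/
theorem eLpNorm_lintegral_le {X Y : Type*} [MeasurableSpace X] [MeasurableSpace Y]
    (μ : Measure Y) (ν : Measure X) [SFinite μ] [SigmaFinite ν] {p : ℝ≥0∞} (hp : 1 ≤ p)
    (hp' : p ≠ ∞) {F : Y → X → ℝ≥0∞} (hF : Measurable (Function.uncurry F)) :
    eLpNorm (fun x => ∫⁻ y, F y x ∂μ) p ν ≤ ∫⁻ y, eLpNorm (F y) p ν ∂μ := by
  have hp0 : p ≠ 0 := (zero_lt_one.trans_le hp).ne'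
  have hpr : 1 ≤ p.toReal := by
    simpa using ENNReal.toReal_mono hp' hp
  simp_rw [eLpNorm_eq_lintegral_rpow_enorm_toReal hp0 hp', enorm_eq_self]
  refine (ENNReal.rpow_le_rpow (lintegral_lintegral_rpow_le μ ν hpr hF) (by positivity)).trans_eq ?_
  rw [← ENNReal.rpow_mul, mul_one_div_cancel (by positivity), ENNReal.rpow_one]

/-- A form of **Young's convolution inequality** where the kernel is controlled by its supremum
and its integral. -/
theorem eLpNorm_lconvolution_le {k N : ℝ → ℝ≥0∞} (hk : Measurable k) (hN : Measurable N)
    {S T : ℝ≥0∞} (hS : ∀ t, k t ≤ S) (hT : ∫⁻ t, k t ≤ T) {p r : ℝ≥0∞} (hp : 1 ≤ p)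
    (hpr : p ≤ r) :
    eLpNorm (fun x => ∫⁻ y, k (x - y) * N y) r volume ≤
      T ^ (1 - (1 / p).toReal + (1 / r).toReal) * S ^ ((1 / p).toReal - (1 / r).toReal) *
        eLpNorm N p volume := by
  have hkT : ∀ x, ∫⁻ y, k (x - y) ≤ T := fun x =>
    (lintegral_sub_left_eq_self k x).trans_le hT
  have hkm : ∀ x, Measurable fun y => k (x - y) := fun x => by fun_prop
  rcases eq_or_ne p ∞ with rfl | hp'
  · obtain rfl : r = ∞ := top_le_iff.1 hpr
    simp only [one_div, ENNReal.inv_top, ENNReal.toReal_zero, sub_zero, add_zero, ENNReal.rpow_one,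
      ENNReal.rpow_zero, mul_one, eLpNorm_exponent_top]
    refine essSup_le_of_ae_le _ (Filter.Eventually.of_forall fun x => ?_)
    simp only [enorm_eq_self]
    calc ∫⁻ y, k (x - y) * N y ≤ ∫⁻ y, k (x - y) * eLpNormEssSup N volume := by
          refine lintegral_mono_ae ?_
          filter_upwards [ae_le_eLpNormEssSup (f := N) (μ := volume)] with y hy
          gcongr
          simpa using hy
      _ = (∫⁻ y, k (x - y)) * eLpNormEssSup N volume := lintegral_mul_const _ (hkm x)
      _ ≤ _ := by gcongr; exact hkT x
  have hp0 : p ≠ 0 := (zero_lt_one.trans_le hp).ne'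
  set q := p.toReal with hq
  have hq1 : 1 ≤ q := by simpa using ENNReal.toReal_mono hp' hp
  have hq0 : 0 < q := by linarith
  have hqi : (1 / p).toReal = 1 / q := by simp [hq]
  set U := ∫⁻ y, N y ^ q with hU
  have hNU : eLpNorm N p volume = U ^ (1 / q) := by
    simp_rw [eLpNorm_eq_lintegral_rpow_enorm_toReal hp0 hp', enorm_eq_self, hU, hq]
  have step : ∀ x, ∫⁻ y, k (x - y) * N y ≤
      T ^ (1 - 1 / q) * (∫⁻ y, k (x - y) * N y ^ q) ^ (1 / q) := by
    intro x
    rcases hq1.eq_or_lt with h | h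
    · simp [← h]
    have hc := (Real.HolderConjugate.conjExponent h).symm
    set s := Real.conjExponent q
    have hs := hc.pos
    have hsq : 1 / s = 1 - 1 / q := by
      have := hc.inv_add_inv_eq_one
      simp only [one_div]; linarith
    have := ENNReal.lintegral_mul_le_Lp_mul_Lq volume hc
      ((hkm x).pow_const (1 / s)).aemeasurable
      (((hkm x).pow_const (1 / q)).mul hN).aemeasurable
    calc ∫⁻ y, k (x - y) * N y
        = ∫⁻ y, k (x - y) ^ (1 / s) * (k (x - y) ^ (1 / q) * N y) := by
          refine lintegral_congr fun y => ?_
          rw [← mul_assoc, ← ENNReal.rpow_add_of_nonneg _ _ (by positivity) (by positivity), hsq,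
            sub_add_cancel, ENNReal.rpow_one]
      _ ≤ _ := this
      _ = (∫⁻ y, k (x - y)) ^ (1 / s) * (∫⁻ y, k (x - y) * N y ^ q) ^ (1 / q) := by
          congr 2
          · refine lintegral_congr fun y => ?_
            rw [← ENNReal.rpow_mul, one_div_mul_cancel hs.ne', ENNReal.rpow_one]
          · refine lintegral_congr fun y => ?_
            rw [Pi.mul_apply, ENNReal.mul_rpow_of_nonneg _ _ hq0.le, ← ENNReal.rpow_mul,
              one_div_mul_cancel hq0.ne', ENNReal.rpow_one]
      _ ≤ _ := by
          rw [hsq]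
          gcongr
          · rw [← hsq]; positivity
          · exact hkT x
  have hkM : ∀ x, ∫⁻ y, k (x - y) * N y ^ q ≤ S * U := fun x => by
    rw [hU, ← lintegral_const_mul _ (hN.pow_const q)]
    gcongr
    exact hS _
  rcases eq_or_ne r ∞ with rfl | hr'
  · simp only [ENNReal.div_top, ENNReal.toReal_zero, add_zero, sub_zero, hqi, hNU,
      eLpNorm_exponent_top]
    refine essSup_le_of_ae_le _ (Filter.Eventually.of_forall fun x => ?_)
    simp only [enorm_eq_self]
    refine (step x).trans ?_
    rw [mul_assoc, ← ENNReal.mul_rpow_of_nonneg _ _ (by positivity : 0 ≤ 1 / q)]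
    gcongr
    exact hkM x
  have hr0 : r ≠ 0 := (zero_lt_one.trans_le (hp.trans hpr)).ne'
  set s := r.toReal with hs
  have hqs : q ≤ s := ENNReal.toReal_mono hr' hpr
  have hs0 : 0 < s := by linarith
  have hri : (1 / r).toReal = 1 / s := by simp [hs]
  have hq1' : 0 ≤ 1 - 1 / q := by
    rw [sub_nonneg, div_le_one hq0]; exact hq1
  have hsq1 : 0 ≤ s / q - 1 := by
    rw [sub_nonneg, one_le_div hq0]; exact hqs
  rw [hqi, hri, hNU]
  simp_rw [eLpNorm_eq_lintegral_rpow_enorm_toReal hr0 hr', enorm_eq_self, ← hs]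
  have hmeas : Measurable (Function.uncurry fun x y => k (x - y) * N y ^ q) := by
    simp only [Function.uncurry_def]; fun_prop
  have hKU : ∫⁻ x, ∫⁻ y, k (x - y) * N y ^ q ≤ T * U := by
    rw [lintegral_lintegral_swap hmeas.aemeasurable, hU, ← lintegral_const_mul _ (hN.pow_const q)]
    refine lintegral_mono fun y => ?_
    rw [lintegral_mul_const _ (by fun_prop), lintegral_sub_right_eq_self k y]
    gcongr
  have hmain : ∫⁻ x, (∫⁻ y, k (x - y) * N y) ^ s ≤
      (T ^ (1 - 1 / q)) ^ s * ((S * U) ^ (s / q - 1) * (T * U)) := by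
    calc ∫⁻ x, (∫⁻ y, k (x - y) * N y) ^ s
        ≤ ∫⁻ x, (T ^ (1 - 1 / q)) ^ s * ((S * U) ^ (s / q - 1) * ∫⁻ y, k (x - y) * N y ^ q) := by
          refine lintegral_mono fun x => ?_
          refine (ENNReal.rpow_le_rpow (step x) hs0.le).trans ?_
          rw [ENNReal.mul_rpow_of_nonneg _ _ hs0.le]
          gcongr
          rw [← ENNReal.rpow_mul, show 1 / q * s = (s / q - 1) + 1 by ring,
            ENNReal.rpow_add_of_nonneg _ _ hsq1 zero_le_one, ENNReal.rpow_one]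
          gcongr
          exact hkM x
      _ = (T ^ (1 - 1 / q)) ^ s * ((S * U) ^ (s / q - 1) * ∫⁻ x, ∫⁻ y, k (x - y) * N y ^ q) := by
          rw [lintegral_const_mul _ (hmeas.lintegral_prod_right.const_mul _),
            lintegral_const_mul _ hmeas.lintegral_prod_right]
      _ ≤ _ := by gcongr
  refine (ENNReal.rpow_le_rpow hmain (by positivity)).trans_eq ?_
  have hs1 : 0 ≤ 1 / s := by positivity
  have e1 : 0 ≤ (s / q - 1) * (1 / s) := by positivity
  rw [ENNReal.mul_rpow_of_nonneg _ _ hs1, ENNReal.mul_rpow_of_nonneg _ _ hs1,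
    ENNReal.mul_rpow_of_nonneg _ _ hs1, ← ENNReal.rpow_mul, ← ENNReal.rpow_mul, ← ENNReal.rpow_mul,
    mul_one_div_cancel hs0.ne', mul_one, ENNReal.mul_rpow_of_nonneg _ _ e1,
    ENNReal.rpow_add_of_nonneg _ _ hq1' hs1,
    show (s / q - 1) * (1 / s) = 1 / q - 1 / s by field_simp]
  have e2 : U ^ (1 / q) = U ^ (1 / q - 1 / s) * U ^ (1 / s) := by
    rw [← ENNReal.rpow_add_of_nonneg _ _ _ hs1, sub_add_cancel]
    rw [sub_nonneg]; exact one_div_le_one_div_of_le hq0 hqs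
  rw [e2]
  ring

/-- `f` is twice differentiable, and `f`, `f'`, `f''` are bounded by `K`. -/
def C2Bound (K : ℝ) (f : ℝ → ℝ) : Prop :=
  ∃ f₁ f₂ : ℝ → ℝ, (∀ x, HasDerivAt f (f₁ x) x) ∧ (∀ x, HasDerivAt f₁ (f₂ x) x) ∧
    ∀ x, |f x| ≤ K ∧ |f₁ x| ≤ K ∧ |f₂ x| ≤ K

namespace C2Bound

variable {K L : ℝ} {f g : ℝ → ℝ}

theorem nonneg (hf : C2Bound K f) : 0 ≤ K := by
  obtain ⟨_, _, _, _, h⟩ := hf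
  exact (abs_nonneg _).trans (h 0).1

theorem abs_le (hf : C2Bound K f) (x : ℝ) : |f x| ≤ K := by
  obtain ⟨_, _, _, _, h⟩ := hf
  exact (h x).1

theorem continuous (hf : C2Bound K f) : Continuous f := by
  obtain ⟨_, _, h, _⟩ := hf
  exact continuous_iff_continuousAt.2 fun x => (h x).continuousAt

theorem mono (hf : C2Bound K f) (h : K ≤ L) : C2Bound L f := by
  obtain ⟨f₁, f₂, h₁, h₂, h₃⟩ := hf
  exact ⟨f₁, f₂, h₁, h₂, fun x =>
    ⟨(h₃ x).1.trans h, (h₃ x).2.1.trans h, (h₃ x).2.2.trans h⟩⟩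

theorem const (c : ℝ) : C2Bound |c| fun _ => c :=
  ⟨fun _ => 0, fun _ => 0, fun x => hasDerivAt_const x c, fun x => hasDerivAt_const x 0,
    fun _ => by simp⟩

theorem add (hf : C2Bound K f) (hg : C2Bound L g) : C2Bound (K + L) fun x => f x + g x := by
  obtain ⟨f₁, f₂, hf₁, hf₂, hf₃⟩ := hf
  obtain ⟨g₁, g₂, hg₁, hg₂, hg₃⟩ := hg
  refine ⟨fun x => f₁ x + g₁ x, fun x => f₂ x + g₂ x, fun x => (hf₁ x).add (hg₁ x),
    fun x => (hf₂ x).add (hg₂ x), fun x => ?_⟩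
  obtain ⟨a, b, c⟩ := hf₃ x
  obtain ⟨a', b', c'⟩ := hg₃ x
  exact ⟨(abs_add_le _ _).trans (by linarith), (abs_add_le _ _).trans (by linarith),
    (abs_add_le _ _).trans (by linarith)⟩

theorem mul (hf : C2Bound K f) (hg : C2Bound L g) :
    C2Bound (4 * (K * L)) fun x => f x * g x := by
  have hK := hf.nonneg
  have hL := hg.nonneg
  obtain ⟨f₁, f₂, hf₁, hf₂, hf₃⟩ := hf
  obtain ⟨g₁, g₂, hg₁, hg₂, hg₃⟩ := hg
  refine ⟨fun x => f₁ x * g x + f x * g₁ x,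
    fun x => (f₂ x * g x + f₁ x * g₁ x) + (f₁ x * g₁ x + f x * g₂ x),
    fun x => (hf₁ x).mul (hg₁ x),
    fun x => ((hf₂ x).mul (hg₁ x)).add ((hf₁ x).mul (hg₂ x)), fun x => ?_⟩
  obtain ⟨a, b, c⟩ := hf₃ x
  obtain ⟨a', b', c'⟩ := hg₃ x
  have key : ∀ s t : ℝ, |s| ≤ K → |t| ≤ L → |s * t| ≤ K * L := fun s t hs ht => by
    rw [abs_mul]; exact mul_le_mul hs ht (abs_nonneg _) hK
  have hKL : 0 ≤ K * L := mul_nonneg hK hL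
  refine ⟨(key _ _ a a').trans (by linarith), ?_, ?_⟩
  · refine (abs_add_le _ _).trans ?_
    have h1 := key _ _ b a'
    have h2 := key _ _ a b'
    linarith
  · refine (abs_add_le _ _).trans ?_
    have h1 := abs_add_le (f₂ x * g x) (f₁ x * g₁ x)
    have h2 := abs_add_le (f₁ x * g₁ x) (f x * g₂ x)
    have h3 := key _ _ c a'
    have h4 := key _ _ b b'
    have h5 := key _ _ a c'
    linarith

theorem comp {F F₁ F₂ : ℝ → ℝ} {c M : ℝ} (hc : 0 < c) (hf : C2Bound K f) (hcf : ∀ x, c ≤ f x)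
    (hF₁ : ∀ y, 0 < y → HasDerivAt F (F₁ y) y) (hF₂ : ∀ y, 0 < y → HasDerivAt F₁ (F₂ y) y)
    (hM : ∀ y, c ≤ y → |F y| ≤ M ∧ |F₁ y| ≤ M ∧ |F₂ y| ≤ M) :
    C2Bound (M * (1 + K + K ^ 2)) fun x => F (f x) := by
  have hK := hf.nonneg
  have hM0 : 0 ≤ M := (abs_nonneg _).trans (hM c le_rfl).1
  obtain ⟨f₁, f₂, hf₁, hf₂, hf₃⟩ := hf
  have hpos : ∀ x, 0 < f x := fun x => hc.trans_le (hcf x)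
  refine ⟨fun x => F₁ (f x) * f₁ x, fun x => F₂ (f x) * f₁ x * f₁ x + F₁ (f x) * f₂ x,
    fun x => (hF₁ _ (hpos x)).comp x (hf₁ x),
    fun x => ((hF₂ _ (hpos x)).comp x (hf₁ x)).mul (hf₂ x), fun x => ?_⟩
  obtain ⟨a, b, d⟩ := hf₃ x
  obtain ⟨a', b', d'⟩ := hM _ (hcf x)
  have hMK : 0 ≤ M * K := mul_nonneg hM0 hK
  have hMK2 : 0 ≤ M * K ^ 2 := by positivity
  refine ⟨by nlinarith, ?_, ?_⟩
  · have := mul_le_mul b' b (abs_nonneg _) hM0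
    rw [abs_mul]; nlinarith
  · refine (abs_add_le _ _).trans ?_
    rw [abs_mul, abs_mul, abs_mul]
    have h1 := mul_le_mul b' d (abs_nonneg _) hM0
    have h2 := mul_le_mul (mul_le_mul d' b (abs_nonneg _) hM0) b (abs_nonneg _) hMK
    nlinarith

theorem inv {c : ℝ} (hc : 0 < c) (hf : C2Bound K f) (hcf : ∀ x, c ≤ f x) :
    C2Bound ((c⁻¹ + (c ^ 2)⁻¹ + 2 * (c ^ 3)⁻¹) * (1 + K + K ^ 2)) fun x => (f x)⁻¹ := by
  refine hf.comp (F := fun y => y⁻¹) (F₁ := fun y => -(y ^ 2)⁻¹) (F₂ := fun y => 2 * (y ^ 3)⁻¹)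
    hc hcf (fun y hy => hasDerivAt_inv hy.ne') (fun y hy => ?_) (fun y hy => ?_)
  · have : HasDerivAt (fun y : ℝ => -(y ^ 2)⁻¹) (-(-((2 : ℕ) * y ^ (2 - 1)) / (y ^ 2) ^ 2)) y :=
      ((hasDerivAt_pow 2 y).inv (by positivity)).neg
    refine this.congr_deriv ?_
    field_simp
    norm_num
    ring
  · have hy0 : 0 < y := hc.trans_le hy
    have h1 : y⁻¹ ≤ c⁻¹ := by gcongr
    have h2 : (y ^ 2)⁻¹ ≤ (c ^ 2)⁻¹ := by gcongr
    have h3 : (y ^ 3)⁻¹ ≤ (c ^ 3)⁻¹ := by gcongr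
    have p1 : 0 < c⁻¹ := by positivity
    have p2 : 0 < (c ^ 2)⁻¹ := by positivity
    have p3 : 0 < (c ^ 3)⁻¹ := by positivity
    rw [abs_neg, abs_of_pos (by positivity : 0 < y⁻¹), abs_of_pos (by positivity : 0 < (y ^ 2)⁻¹),
      abs_of_pos (by positivity : 0 < 2 * (y ^ 3)⁻¹)]
    exact ⟨by linarith, by linarith, by linarith⟩

theorem invSqrt {c : ℝ} (hc : 0 < c) (hf : C2Bound K f) (hcf : ∀ x, c ≤ f x) :
    C2Bound ((c ^ (-(1 : ℝ) / 2) + c ^ (-(3 : ℝ) / 2) + c ^ (-(5 : ℝ) / 2)) * (1 + K + K ^ 2))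
      fun x => f x ^ (-(1 : ℝ) / 2) := by
  refine hf.comp (F := fun y => y ^ (-(1 : ℝ) / 2)) (F₁ := fun y => -(1 / 2) * y ^ (-(3 : ℝ) / 2))
    (F₂ := fun y => 3 / 4 * y ^ (-(5 : ℝ) / 2)) hc hcf (fun y hy => ?_) (fun y hy => ?_)
    (fun y hy => ?_)
  · refine (hasDerivAt_rpow_const (p := -(1 : ℝ) / 2) (Or.inl hy.ne')).congr_deriv ?_
    norm_num
  · refine ((hasDerivAt_rpow_const (p := -(3 : ℝ) / 2) (Or.inl hy.ne')).const_mul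
      (-(1 / 2) : ℝ)).congr_deriv ?_
    rw [← mul_assoc]
    norm_num
  · have hy0 : 0 < y := hc.trans_le hy
    have h : ∀ s : ℝ, s ≤ 0 → y ^ s ≤ c ^ s := fun s hs => rpow_le_rpow_of_nonpos hc hy hs
    have h1 := h (-(1 : ℝ) / 2) (by norm_num)
    have h2 := h (-(3 : ℝ) / 2) (by norm_num)
    have h3 := h (-(5 : ℝ) / 2) (by norm_num)
    have q1 := rpow_pos_of_pos hc (-(1 : ℝ) / 2)
    have q2 := rpow_pos_of_pos hc (-(3 : ℝ) / 2)
    have q3 := rpow_pos_of_pos hc (-(5 : ℝ) / 2)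
    have p1 := rpow_pos_of_pos hy0 (-(1 : ℝ) / 2)
    have p2 := rpow_pos_of_pos hy0 (-(3 : ℝ) / 2)
    have p3 := rpow_pos_of_pos hy0 (-(5 : ℝ) / 2)
    rw [abs_mul, abs_mul, abs_of_pos p1, abs_of_pos p2, abs_of_pos p3]
    norm_num [abs_of_pos]
    exact ⟨by linarith, by linarith, by linarith⟩

theorem exp_neg {c σ : ℝ} (hc : 0 < c) (hσ : 0 ≤ σ) (hf : C2Bound K f) (hcf : ∀ x, c ≤ f x) :
    C2Bound ((1 + 2 / c + 8 / c ^ 2) * (1 + K + K ^ 2) * rexp (-(c / 2 * σ)))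
      fun x => rexp (-(σ * f x)) := by
  have hexp' : ∀ y, HasDerivAt (fun y => rexp (-(σ * y))) (-σ * rexp (-(σ * y))) y := fun y => by
    have : HasDerivAt (fun y => -(σ * y)) (-(σ * 1)) y := ((hasDerivAt_id y).const_mul σ).neg
    exact this.exp.congr_deriv (by ring)
  have h := hf.comp (F := fun y => rexp (-(σ * y))) (F₁ := fun y => -σ * rexp (-(σ * y)))
    (F₂ := fun y => σ ^ 2 * rexp (-(σ * y))) (M := (1 + 2 / c + 8 / c ^ 2) * rexp (-(c / 2 * σ)))
    hc hcf (fun y _ => ?_) (fun y _ => ?_) (fun y hy => ?_)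
  · exact h.mono (by ring_nf; rfl)
  · exact hexp' y
  · exact ((hexp' y).const_mul (-σ)).congr_deriv (by ring)
  · have hle : rexp (-(σ * y)) ≤ rexp (-(c / 2 * σ)) * rexp (-(c / 2 * σ)) := by
      rw [← Real.exp_add]
      apply Real.exp_le_exp.2
      nlinarith
    set t := c / 2 * σ with ht
    have ht0 : 0 ≤ t := by positivity
    have hσt : σ = 2 / c * t := by rw [ht]; field_simp
    set e := rexp (-t) with he
    have he0 : 0 < e := Real.exp_pos _
    have he1 : e ≤ 1 := Real.exp_le_one_iff.2 (by linarith)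
    have hinv : e * rexp t = 1 := by rw [he, ← Real.exp_add]; simp
    have hq := Real.quadratic_le_exp_of_nonneg ht0
    have h1 : t * e ≤ 1 := by nlinarith
    have h2 : t ^ 2 * e ≤ 2 := by nlinarith
    have hc1 : 0 < 2 / c := by positivity
    have hc2 : 0 < 8 / c ^ 2 := by positivity
    have hexp := Real.exp_pos (-(σ * y))
    have hee : e * e ≤ e := by nlinarith
    have b1 : σ * rexp (-(σ * y)) ≤ 2 / c * e := by
      calc σ * rexp (-(σ * y)) ≤ σ * (e * e) := by gcongr
        _ = 2 / c * (t * e) * e := by rw [hσt]; ring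
        _ ≤ 2 / c * 1 * e := by gcongr
        _ = _ := by ring
    have b2 : σ ^ 2 * rexp (-(σ * y)) ≤ 8 / c ^ 2 * e := by
      calc σ ^ 2 * rexp (-(σ * y)) ≤ σ ^ 2 * (e * e) := by gcongr
        _ = (2 / c) ^ 2 * (t ^ 2 * e) * e := by rw [hσt]; ring
        _ ≤ (2 / c) ^ 2 * 2 * e := by gcongr
        _ = _ := by ring
    rw [abs_mul, abs_mul, abs_neg, abs_of_nonneg hσ, abs_of_pos hexp,
      abs_of_nonneg (by positivity : 0 ≤ σ ^ 2)]
    have p1 := mul_pos hc1 he0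
    have p2 := mul_pos hc2 he0
    refine ⟨?_, ?_, ?_⟩ <;> nlinarith

theorem of_hasCompactSupport (hf : ContDiff ℝ 2 f) (hs : HasCompactSupport f) :
    ∃ K, C2Bound K f := by
  have h1 : ContDiff ℝ 1 (deriv f) := by
    have : ContDiff ℝ (1 + 1) f := by simpa [one_add_one_eq_two] using hf
    exact (contDiff_succ_iff_deriv.1 this).2.2
  have h2 : Continuous (deriv (deriv f)) := h1.continuous_deriv le_rfl
  obtain ⟨K₀, hK₀⟩ := hs.exists_bound_of_continuous hf.continuous
  obtain ⟨K₁, hK₁⟩ := hs.deriv.exists_bound_of_continuous h1.continuous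
  obtain ⟨K₂, hK₂⟩ := hs.deriv.deriv.exists_bound_of_continuous h2
  refine ⟨max K₀ (max K₁ K₂), deriv f, deriv (deriv f),
    fun x => (hf.differentiable (by norm_num) x).hasDerivAt,
    fun x => (h1.differentiable (by norm_num) x).hasDerivAt, fun x => ?_⟩
  have a := hK₀ x
  have b := hK₁ x
  have c := hK₂ x
  rw [Real.norm_eq_abs] at a b c
  exact ⟨a.trans (le_max_left _ _), b.trans ((le_max_left _ _).trans (le_max_right _ _)),
    c.trans ((le_max_right _ _).trans (le_max_right _ _))⟩

/-- Decay of the inverse Fourier transform of a `C²` function supported in `[-4, 4]`. -/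
theorem norm_fourierInv_le (hf : C2Bound K f) (hs : ∀ x, 4 < |x| → f x = 0) (z : ℝ) :
    ‖𝓕⁻ (fun x => (f x : ℂ)) z‖ ≤ 16 * K * (1 + z ^ 2)⁻¹ := by
  have hK := hf.nonneg
  obtain ⟨f₁, f₂, h₁, h₂, h₃⟩ := hf
  have hopen : IsOpen {x : ℝ | 4 < |x|} := isOpen_lt continuous_const continuous_abs
  have aux : ∀ {u u' : ℝ → ℝ}, (∀ x, HasDerivAt u (u' x) x) → (∀ x, 4 < |x| → u x = 0) →
      ∀ x, 4 < |x| → u' x = 0 := by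
    intro u u' hu hu0 x hx
    refine (hu x).unique ((hasDerivAt_const x (0 : ℝ)).congr_of_eventuallyEq ?_)
    filter_upwards [hopen.mem_nhds hx] with y hy using hu0 y hy
  have hs₁ := aux h₁ hs
  have hs₂ := aux h₂ hs₁
  have integ : ∀ {u : ℝ → ℝ}, Measurable u → (∀ x, |u x| ≤ K) → (∀ x, 4 < |x| → u x = 0) →
      Integrable (fun x => (u x : ℂ)) ∧ ∫ x, ‖(u x : ℂ)‖ ≤ 8 * K := by
    intro u hum hub hu0
    have hle : ∀ x, ‖(u x : ℂ)‖ ≤ (Set.Icc (-4 : ℝ) 4).indicator (fun _ => K) x := by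
      intro x
      by_cases hx : x ∈ Set.Icc (-4 : ℝ) 4
      · simpa [hx] using hub x
      · have : 4 < |x| := by
          by_contra! h
          exact hx (_root_.abs_le.1 h)
        simp [hx, hu0 x this]
    have hi : Integrable ((Set.Icc (-4 : ℝ) 4).indicator fun _ => K) volume :=
      (integrable_indicator_iff measurableSet_Icc).2 (integrableOn_const (by simp) (by simp))
    have hui : Integrable (fun x => (u x : ℂ)) :=
      hi.mono' (by fun_prop) (Filter.Eventually.of_forall hle)
    refine ⟨hui, (integral_mono hui.norm hi hle).trans_eq ?_⟩
    rw [integral_indicator_const _ measurableSet_Icc]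
    simp [Measure.real]
    norm_num
  have d₁ : deriv f = f₁ := funext fun x => (h₁ x).deriv
  have d₂ : deriv f₁ = f₂ := funext fun x => (h₂ x).deriv
  have c₁ : ∀ x, HasDerivAt (fun x => (f x : ℂ)) (f₁ x : ℂ) x := fun x => (h₁ x).ofReal_comp
  have c₂ : ∀ x, HasDerivAt (fun x => (f₁ x : ℂ)) (f₂ x : ℂ) x := fun x => (h₂ x).ofReal_comp
  have m₀ : Measurable f := (continuous_iff_continuousAt.2 fun x => (h₁ x).continuousAt).measurable
  have m₁ : Measurable f₁ := d₁ ▸ measurable_deriv f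
  have m₂ : Measurable f₂ := d₂ ▸ measurable_deriv f₁
  obtain ⟨i₀, b₀⟩ := integ m₀ (fun x => (h₃ x).1) hs
  obtain ⟨i₁, -⟩ := integ m₁ (fun x => (h₃ x).2.1) hs₁
  obtain ⟨i₂, b₂⟩ := integ m₂ (fun x => (h₃ x).2.2) hs₂
  have e₁ : deriv (fun x => (f x : ℂ)) = fun x => (f₁ x : ℂ) := funext fun x => (c₁ x).deriv
  have e₂ : deriv (fun x => (f₁ x : ℂ)) = fun x => (f₂ x : ℂ) := funext fun x => (c₂ x).deriv
  have F₁ := Real.fourier_deriv i₀ (fun x => (c₁ x).differentiableAt) (e₁ ▸ i₁)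
  have F₂ := Real.fourier_deriv i₁ (fun x => (c₂ x).differentiableAt) (e₂ ▸ i₂)
  rw [e₁] at F₁
  rw [e₂, F₁] at F₂
  have hn₀ : ‖𝓕 (fun x => (f x : ℂ)) (-z)‖ ≤ 8 * K :=
    (VectorFourier.norm_fourierIntegral_le_integral_norm _ _ _ _ _).trans b₀
  have hn₂ : ‖𝓕 (fun x => (f₂ x : ℂ)) (-z)‖ ≤ 8 * K :=
    (VectorFourier.norm_fourierIntegral_le_integral_norm _ _ _ _ _).trans b₂
  rw [Real.fourierInv_eq_fourier_neg]
  set A := ‖𝓕 (fun x => (f x : ℂ)) (-z)‖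
  have hz : (2 * π * |z|) ^ 2 * A ≤ 8 * K := by
    rw [F₂] at hn₂
    refine le_trans (le_of_eq ?_) hn₂
    simp [abs_of_pos pi_pos, A]
    ring
  rw [mul_pow, sq_abs] at hz
  have hA : 0 ≤ A := norm_nonneg _
  have hpi : 1 ≤ (2 * π) ^ 2 := by nlinarith [pi_gt_three]
  have : z ^ 2 * A ≤ 8 * K := by
    have h : 0 ≤ z ^ 2 * A := by positivity
    nlinarith
  rw [← div_eq_mul_inv, le_div_iff₀ (by positivity)]
  linarith

end C2Bound

/-- Bounded smooth functions that agree with `η` and `η²` on the annulus `1/2 ≤ |η| ≤ 2`, the first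
one supported in `[-4, 4]` and the second one bounded below. -/
theorem exists_cutoff : ∃ (w θ : ℝ → ℝ) (K c : ℝ), 0 < c ∧ C2Bound K w ∧ C2Bound K θ ∧
    (∀ η, c ≤ θ η) ∧ (∀ η, 4 < |η| → w η = 0) ∧
    ∀ η, 1 / 2 ≤ |η| → |η| ≤ 2 → w η = η ∧ θ η = η ^ 2 := by
  let χ : ContDiffBump (0 : ℝ) := ⟨2, 4, by norm_num, by norm_num⟩
  let ρ : ContDiffBump (0 : ℝ) := ⟨1 / 4, 1 / 2, by norm_num, by norm_num⟩
  have hχ1 : ∀ η : ℝ, |η| ≤ 2 → χ η = 1 := fun η h =>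
    χ.one_of_mem_closedBall (by simpa [χ] using h)
  have hχ0 : ∀ η : ℝ, 4 ≤ |η| → χ η = 0 := fun η h =>
    χ.zero_of_le_dist (by simpa [χ] using h)
  have hρ1 : ∀ η : ℝ, |η| ≤ 1 / 4 → ρ η = 1 := fun η h =>
    ρ.one_of_mem_closedBall (by simpa [ρ] using h)
  have hρ0 : ∀ η : ℝ, 1 / 2 ≤ |η| → ρ η = 0 := fun η h =>
    ρ.zero_of_le_dist (by simpa [ρ] using h)
  have sχ : ContDiff ℝ 2 χ := χ.contDiff
  have sρ : ContDiff ℝ 2 ρ := ρ.contDiff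
  obtain ⟨K₁, h₁⟩ := C2Bound.of_hasCompactSupport (f := fun η => χ η * η)
    (sχ.mul contDiff_id) χ.hasCompactSupport.mul_right
  obtain ⟨K₂, h₂⟩ := C2Bound.of_hasCompactSupport (f := fun η => χ η * (η ^ 2 - 1) + ρ η)
    ((sχ.mul ((contDiff_id.pow 2).sub contDiff_const)).add sρ)
    (χ.hasCompactSupport.mul_right.add ρ.hasCompactSupport)
  have h₃ := (C2Bound.const 1).add h₂
  refine ⟨fun η => χ η * η, fun η => 1 + (χ η * (η ^ 2 - 1) + ρ η), max K₁ (|1| + K₂), 1 / 16,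
    by norm_num, h₁.mono (le_max_left _ _), h₃.mono (le_max_right _ _), fun η => ?_,
    fun η h => by simp [hχ0 η h.le], fun η h h' => by simp [hχ1 η h', hρ0 η h]⟩
  beta_reduce
  have a := χ.nonneg (x := η)
  have b := χ.le_one (x := η)
  have d := ρ.nonneg (x := η)
  rcases le_total |η| (1 / 4) with h | h
  · rw [hχ1 η (by linarith), hρ1 η h]
    nlinarith [sq_nonneg η]
  · have : 1 / 16 ≤ η ^ 2 := by rw [← sq_abs]; nlinarith
    nlinarith

/-- The normalised multipliers, uniformly over the compactified parameter range. -/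
theorem exists_uniform_multiplier_bound {w θ : ℝ → ℝ} {K₀ c₀ : ℝ} (hc₀ : 0 < c₀)
    (hw : C2Bound K₀ w) (hθ : C2Bound K₀ θ) (hθc : ∀ η, c₀ ≤ θ η) :
    ∃ K c : ℝ, 0 < K ∧ 0 < c ∧ ∀ u v : ℝ, 0 ≤ u → u ≤ 1 → 0 ≤ v → v ≤ 1 → (u = 1 ∨ v = 1) →
      ∀ σ, 0 ≤ σ →
      C2Bound (K * rexp (-(c * σ))) (fun η => w η * (u ^ 2 + 16 * π ^ 2 * v ^ 2 * θ η) ^ (-(1:ℝ)/2) *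
        rexp (-(σ * (8 * π ^ 2 * θ η * (u + √(u ^ 2 + 16 * π ^ 2 * v ^ 2 * θ η))⁻¹)))) ∧
      C2Bound (K * rexp (-(c * σ))) (fun η => w η * (u ^ 2 + 16 * π ^ 2 * v ^ 2 * θ η) ^ (-(1:ℝ)/2) *
        rexp (-(σ * (1 / 2 * (u + √(u ^ 2 + 16 * π ^ 2 * v ^ 2 * θ η)))))) := by
  set c₁ := min 1 (16 * π ^ 2 * c₀) with hc₁
  have hc₁0 : 0 < c₁ := lt_min one_pos (by positivity)
  have hK₀ := hθ.nonneg
  let Q : ℝ → ℝ → ℝ → ℝ := fun u v η => u ^ 2 + 16 * π ^ 2 * v ^ 2 * θ η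
  let P : ℝ → ℝ → Prop := fun u v => 0 ≤ u ∧ u ≤ 1 ∧ 0 ≤ v ∧ v ≤ 1 ∧ (u = 1 ∨ v = 1)
  have hQc : ∀ u v, P u v → ∀ η, c₁ ≤ Q u v η := by
    rintro u v ⟨hu, hu1, hv, hv1, h⟩ η
    have hθη := hθc η
    have : 0 < θ η := hc₀.trans_le hθη
    rcases h with rfl | rfl
    · refine (min_le_left _ _).trans ?_
      have : 0 ≤ 16 * π ^ 2 * v ^ 2 * θ η := by positivity
      simp only [Q]; linarith
    · refine (min_le_right _ _).trans ?_
      have : 16 * π ^ 2 * c₀ ≤ 16 * π ^ 2 * θ η := by gcongr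
      simp only [Q]; nlinarith [sq_nonneg u]
  obtain ⟨K₁, hQ⟩ : ∃ K₁, ∀ u v, P u v → C2Bound K₁ (Q u v) := by
    refine ⟨1 + 4 * (16 * π ^ 2 * K₀), fun u v h => ?_⟩
    obtain ⟨hu, hu1, hv, hv1, -⟩ := h
    refine ((C2Bound.const (u ^ 2)).add ((C2Bound.const (16 * π ^ 2 * v ^ 2)).mul hθ)).mono ?_
    rw [abs_of_nonneg (by positivity), abs_of_nonneg (by positivity)]
    have h1 : u ^ 2 ≤ 1 := pow_le_one₀ hu hu1
    have h2 : v ^ 2 ≤ 1 := pow_le_one₀ hv hv1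
    have h3 : 16 * π ^ 2 * v ^ 2 ≤ 16 * π ^ 2 := mul_le_of_le_one_right (by positivity) h2
    have h4 := mul_le_mul_of_nonneg_right h3 hK₀
    linarith
  obtain ⟨K₂, hq⟩ : ∃ K₂, ∀ u v, P u v → C2Bound K₂ fun η => Q u v η ^ (-(1:ℝ)/2) :=
    ⟨_, fun u v h => (hQ u v h).invSqrt hc₁0 (hQc u v h)⟩
  obtain ⟨K₃, hD⟩ : ∃ K₃, ∀ u v, P u v → C2Bound K₃ fun η => u + √(Q u v η) := by
    refine ⟨1 + 4 * (K₁ * K₂), fun u v h => ?_⟩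
    have := (C2Bound.const u).add ((hQ u v h).mul (hq u v h))
    have hu1 : |u| ≤ 1 := by rw [abs_of_nonneg h.1]; exact h.2.1
    convert this.mono (add_le_add_left hu1 _) using 3 with η
    have hpos : 0 < Q u v η := hc₁0.trans_le (hQc u v h η)
    conv_rhs => rw [← rpow_one (Q u v η), ← rpow_mul hpos.le, ← rpow_add hpos]
    rw [sqrt_eq_rpow]
    norm_num
  have hDc : ∀ u v, P u v → ∀ η, √c₁ ≤ u + √(Q u v η) := fun u v h η => by
    have := Real.sqrt_le_sqrt (hQc u v h η)
    linarith [h.1]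
  have hsc : 0 < √c₁ := Real.sqrt_pos.2 hc₁0
  have hP : P 1 1 := ⟨zero_le_one, le_rfl, zero_le_one, le_rfl, Or.inl rfl⟩
  have hK₃ : 0 < K₃ :=
    hsc.trans_le ((hDc 1 1 hP 0).trans ((le_abs_self _).trans ((hD 1 1 hP).abs_le 0)))
  obtain ⟨K₄, hM⟩ : ∃ K₄, ∀ u v, P u v →
      C2Bound K₄ fun η => 8 * π ^ 2 * θ η * (u + √(Q u v η))⁻¹ :=
    ⟨_, fun u v h => ((C2Bound.const (8 * π ^ 2)).mul hθ).mul ((hD u v h).inv hsc (hDc u v h))⟩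
  have hMc : ∀ u v, P u v → ∀ η, 8 * π ^ 2 * c₀ * K₃⁻¹ ≤ 8 * π ^ 2 * θ η * (u + √(Q u v η))⁻¹ := by
    intro u v h η
    have h1 := hsc.trans_le (hDc u v h η)
    have h2 := (le_abs_self _).trans ((hD u v h).abs_le η)
    have h3 := hθc η
    have h4 : 0 < θ η := hc₀.trans_le h3
    gcongr
  obtain ⟨K₅, hN⟩ : ∃ K₅, ∀ u v, P u v → C2Bound K₅ fun η => 1 / 2 * (u + √(Q u v η)) :=
    ⟨_, fun u v h => (C2Bound.const (1 / 2)).mul (hD u v h)⟩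
  set c := min (8 * π ^ 2 * c₀ * K₃⁻¹) (1 / 2 * √c₁) with hc
  have hc0 : 0 < c := lt_min (by positivity) (by positivity)
  have hMc' : ∀ u v, P u v → ∀ η, c ≤ 8 * π ^ 2 * θ η * (u + √(Q u v η))⁻¹ := fun u v h η =>
    (min_le_left _ _).trans (hMc u v h η)
  have hNc' : ∀ u v, P u v → ∀ η, c ≤ 1 / 2 * (u + √(Q u v η)) := fun u v h η =>
    (min_le_right _ _).trans (by have := hDc u v h η; gcongr)
  set B := fun K : ℝ => 4 * (4 * (K₀ * K₂) * ((1 + 2 / c + 8 / c ^ 2) * (1 + K + K ^ 2)))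
  refine ⟨max 1 (max (B K₄) (B K₅)), c / 2, lt_max_of_lt_left one_pos, half_pos hc0,
    fun u v hu hu1 hv hv1 h σ hσ => ?_⟩
  have h : P u v := ⟨hu, hu1, hv, hv1, h⟩
  have hwq := hw.mul (hq u v h)
  constructor
  · refine (hwq.mul ((hM u v h).exp_neg hc0 hσ (hMc' u v h))).mono ?_
    have : B K₄ ≤ max 1 (max (B K₄) (B K₅)) := (le_max_left _ _).trans (le_max_right _ _)
    refine le_trans (le_of_eq ?_) (mul_le_mul_of_nonneg_right this (Real.exp_pos _).le)
    simp only [B]; ring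
  · refine (hwq.mul ((hN u v h).exp_neg hc0 hσ (hNc' u v h))).mono ?_
    have : B K₅ ≤ max 1 (max (B K₄) (B K₅)) := (le_max_right _ _).trans (le_max_right _ _)
    refine le_trans (le_of_eq ?_) (mul_le_mul_of_nonneg_right this (Real.exp_pos _).le)
    simp only [B]; ring

theorem norm_fourierInv_comp_div (f : ℝ → ℂ) {L : ℝ} (hL : 0 < L) (z : ℝ) :
    ‖𝓕⁻ (fun ξ => f (L⁻¹ * ξ)) z‖ = L * ‖𝓕⁻ f (L * z)‖ := by
  rw [Real.fourierInv_eq', Real.fourierInv_eq']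
  have := Measure.integral_comp_mul_left
    (fun η : ℝ => Complex.exp (((2 * π * inner ℝ η (L * z) : ℝ) : ℂ) * Complex.I) • f η) L⁻¹
  rw [inv_inv, abs_of_pos hL] at this
  rw [← Real.norm_of_nonneg hL.le, ← norm_smul, Real.norm_of_nonneg hL.le, ← this]
  congr 1
  refine integral_congr_ae (Filter.Eventually.of_forall fun ξ => ?_)
  have : inner ℝ (L⁻¹ * ξ) (L * z) = inner ℝ ξ z := by
    simp only [RCLike.inner_apply, conj_trivial]
    field_simp
  simp only [this]

/-- The exponential factor of the resolvent kernel, with the decaying root on either side. -/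
def decayFactor (α ξ t : ℝ) : ℝ :=
  if 0 ≤ t then rexp (lamM α (2 * π * ξ) * t) else rexp (lamP α (2 * π * ξ) * t)

/-- At frequency `|ξ| ∼ L` the multiplier coincides with the Fourier transform of a kernel with
integrable decay. -/
theorem exists_multiplier : ∃ C c : ℝ, 0 < C ∧ 0 < c ∧ ∀ α L : ℝ, 0 < α → 0 < L → ∀ t : ℝ,
    ∃ H : ℝ → ℝ, Continuous H ∧ (∀ ξ, 4 * L < |ξ| → H ξ = 0) ∧
      (∀ ξ, 1 / 2 ≤ |L⁻¹ * ξ| → |L⁻¹ * ξ| ≤ 2 →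
        H ξ = (α ^ 2 + 16 * π ^ 2 * ξ ^ 2) ^ (-(1:ℝ)/2) * ξ * decayFactor α ξ t) ∧
      ∀ z, ‖𝓕⁻ (fun ξ => (H ξ : ℂ)) z‖ ≤
        C * (max 1 (α / L))⁻¹ * rexp (-(c * (L * |t| / max 1 (α / L)))) *
          (L * (1 + (L * z) ^ 2)⁻¹) := by
  obtain ⟨w, θ, K₀, c₀, hc₀, hw, hθ, hθc, hw0, hwθ⟩ := exists_cutoff
  obtain ⟨K, c, hK, hc, hB⟩ := exists_uniform_multiplier_bound hc₀ hw hθ hθc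
  refine ⟨16 * K, c, by positivity, hc, fun α L hα hL t => ?_⟩
  set μ := max 1 (α / L) with hμ
  have hμ1 : 1 ≤ μ := le_max_left _ _
  have hμ0 : 0 < μ := by linarith
  set u := α / (L * μ) with hu
  set v := μ⁻¹ with hv
  have hu0 : 0 ≤ u := by positivity
  have hu1 : u ≤ 1 := by
    rw [hu, ← div_div, div_le_one hμ0]; exact le_max_right _ _
  have hv0 : 0 ≤ v := by positivity
  have hv1 : v ≤ 1 := inv_le_one_of_one_le₀ hμ1
  have huv : u = 1 ∨ v = 1 := by
    rcases max_choice 1 (α / L) with h | h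
    · right; rw [hv, hμ, h, inv_one]
    · left; rw [hu, ← div_div, hμ, h, div_self (by positivity)]
  have hαu : α = L * μ * u := by rw [hu]; field_simp
  have hQ : ∀ η, α ^ 2 + 16 * π ^ 2 * (L * η) ^ 2 =
      (L * μ) ^ 2 * (u ^ 2 + 16 * π ^ 2 * v ^ 2 * η ^ 2) := fun η => by
    rw [hαu, hv]; field_simp
  -- it suffices to find the profile at unit frequency
  suffices h : ∃ f : ℝ → ℝ, C2Bound (K * rexp (-(c * (L * |t| / μ)))) f ∧
      (∀ η, 4 < |η| → f η = 0) ∧ ∀ η, 1 / 2 ≤ |η| → |η| ≤ 2 →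
        f η = η * (u ^ 2 + 16 * π ^ 2 * v ^ 2 * η ^ 2) ^ (-(1:ℝ)/2) * decayFactor α (L * η) t by
    obtain ⟨f, hf, hf0, hfe⟩ := h
    refine ⟨fun ξ => μ⁻¹ * f (L⁻¹ * ξ), ?_, fun ξ hξ => ?_, fun ξ h1 h2 => ?_, fun z => ?_⟩
    · have := hf.continuous
      fun_prop
    · beta_reduce
      rw [hf0, mul_zero]
      rw [abs_mul, abs_of_pos (inv_pos.2 hL), inv_mul_eq_div, lt_div_iff₀ hL]
      exact hξ
    · obtain ⟨η, rfl⟩ : ∃ η, ξ = L * η := ⟨L⁻¹ * ξ, by field_simp⟩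
      beta_reduce
      rw [inv_mul_cancel_left₀ hL.ne'] at h1 h2 ⊢
      have hLμ : ((L * μ) ^ 2) ^ (-(1:ℝ) / 2) = (L * μ)⁻¹ := by
        rw [← rpow_natCast, ← rpow_mul (by positivity), ← rpow_neg_one]
        norm_num
      rw [hfe η h1 h2, hQ, mul_rpow (by positivity) (by positivity), hLμ]
      field_simp
    · have h1 := norm_fourierInv_comp_div (fun η => (f η : ℂ)) hL z
      have h2 := hf.norm_fourierInv_le hf0 (L * z)
      have h3 : 𝓕⁻ (fun ξ => ((μ⁻¹ * f (L⁻¹ * ξ) : ℝ) : ℂ)) z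
          = ((μ⁻¹ : ℝ) : ℂ) * 𝓕⁻ (fun ξ => ((f (L⁻¹ * ξ) : ℝ) : ℂ)) z := by
        rw [Real.fourierInv_eq', Real.fourierInv_eq', ← integral_const_mul]
        congr 1; ext ξ
        push_cast
        simp only [smul_eq_mul]
        ring
      rw [h3, norm_mul, h1, Complex.norm_real, Real.norm_of_nonneg (by positivity)]
      calc μ⁻¹ * (L * ‖𝓕⁻ (fun η => (f η : ℂ)) (L * z)‖) ≤ μ⁻¹ * (L *
            (16 * (K * rexp (-(c * (L * |t| / μ)))) * (1 + (L * z) ^ 2)⁻¹)) := by gcongr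
        _ = _ := by ring
  have hsq : ∀ η, √(α ^ 2 + 4 * (2 * π * (L * η)) ^ 2) =
      L * μ * √(u ^ 2 + 16 * π ^ 2 * v ^ 2 * η ^ 2) := fun η => by
    rw [show α ^ 2 + 4 * (2 * π * (L * η)) ^ 2 = α ^ 2 + 16 * π ^ 2 * (L * η) ^ 2 by ring, hQ,
      Real.sqrt_mul (by positivity), Real.sqrt_sq (by positivity)]
  rcases le_or_gt 0 t with ht | ht
  · refine ⟨_, (hB u v hu0 hu1 hv0 hv1 huv (L * |t| / μ) (by positivity)).1, fun η hη => ?_,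
      fun η h1 h2 => ?_⟩
    · simp [hw0 η hη]
    · obtain ⟨e1, e2⟩ := hwθ η h1 h2
      rw [e1, e2, decayFactor, if_pos ht, lamM, hsq, abs_of_nonneg ht]
      congr 2
      have hη : 0 < η ^ 2 := by rw [← sq_abs]; have : 0 < |η| := by linarith
                                positivity
      set R := √(u ^ 2 + 16 * π ^ 2 * v ^ 2 * η ^ 2) with hR
      have hR2 : R ^ 2 = u ^ 2 + 16 * π ^ 2 * v ^ 2 * η ^ 2 := Real.sq_sqrt (by positivity)
      have hR0 : 0 < R := Real.sqrt_pos.2 (by positivity)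
      have hD : 0 < u + R := by positivity
      have hvμ : μ * v = 1 := mul_inv_cancel₀ hμ0.ne'
      have key : 8 * π ^ 2 * η ^ 2 * (u + R)⁻¹ = μ ^ 2 * (R - u) / 2 := by
        rw [← div_eq_mul_inv, div_eq_iff hD.ne']
        calc 8 * π ^ 2 * η ^ 2 = (μ * v) ^ 2 * (8 * π ^ 2 * η ^ 2) := by rw [hvμ]; ring
          _ = μ ^ 2 / 2 * (R ^ 2 - u ^ 2) := by rw [hR2]; ring
          _ = _ := by ring
      rw [key, hαu]
      field_simp
      ring
  · refine ⟨_, (hB u v hu0 hu1 hv0 hv1 huv (L * |t| * μ) (by positivity)).2.mono ?_,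
      fun η hη => ?_, fun η h1 h2 => ?_⟩
    · have : L * |t| / μ ≤ L * |t| * μ := by
        rw [div_le_iff₀ hμ0, mul_assoc]
        exact le_mul_of_one_le_right (by positivity) (one_le_mul_of_one_le_of_one_le hμ1 hμ1)
      gcongr
    · simp [hw0 η hη]
    · obtain ⟨e1, e2⟩ := hwθ η h1 h2
      rw [e1, e2, decayFactor, if_neg ht.not_ge, lamP, hsq, abs_of_neg ht]
      congr 2
      rw [hαu]
      ring

theorem mixedNorm_eq_eLpNorm {p₁ : ℝ≥0∞} (h₁ : 1 ≤ p₁) (p₂ : ℝ≥0∞) (h : ℝ → ℝ → ℂ) :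
    mixedNorm p₁ p₂ h = eLpNorm (fun x => eLpNorm (h x) p₂ volume) p₁ volume := by
  have h0 : p₁ ≠ 0 := (zero_lt_one.trans_le h₁).ne'
  rw [mixedNorm]
  split_ifs with htop
  · subst htop
    simp [eLpNormEssSup]
  · simp [eLpNorm_eq_lintegral_rpow_enorm_toReal h0 htop]

theorem Continuous.enorm_le_eLpNorm_top {f : ℝ → ℂ} (hf : Continuous f) (x : ℝ) :
    ‖f x‖ₑ ≤ eLpNorm f ∞ volume := by
  rw [eLpNorm_exponent_top]
  have hd : Dense {x | ‖f x‖ₑ ≤ eLpNormEssSup f volume} :=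
    Measure.dense_of_ae (ae_le_eLpNormEssSup (f := f) (μ := volume))
  have hc : IsClosed {x | ‖f x‖ₑ ≤ eLpNormEssSup f volume} :=
    isClosed_le hf.enorm continuous_const
  have := hd x
  rwa [hc.closure_eq] at this

theorem measurable_eLpNorm_of_continuous {G : ℝ → ℝ → ℂ} (hG : Measurable (Function.uncurry G))
    (hc : ∀ y, Continuous (G y)) {p : ℝ≥0∞} (hp : 1 ≤ p) :
    Measurable fun y => eLpNorm (G y) p volume := by
  have h0 : p ≠ 0 := (zero_lt_one.trans_le hp).ne'
  rcases eq_or_ne p ∞ with rfl | hp'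
  · have : (fun y => eLpNorm (G y) ∞ volume) = fun y => ⨆ q : ℚ, ‖G y q‖ₑ := by
      funext y
      refine le_antisymm ?_ (iSup_le fun q => (hc y).enorm_le_eLpNorm_top q)
      rw [eLpNorm_exponent_top]
      refine essSup_le_of_ae_le _ (Filter.Eventually.of_forall fun x => ?_)
      have hcl : IsClosed {x | ‖G y x‖ₑ ≤ ⨆ q : ℚ, ‖G y q‖ₑ} :=
        isClosed_le (hc y).enorm continuous_const
      have hsub : Set.range ((↑) : ℚ → ℝ) ⊆ {x | ‖G y x‖ₑ ≤ ⨆ q : ℚ, ‖G y q‖ₑ} := by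
        rintro _ ⟨q, rfl⟩
        exact le_iSup (fun q : ℚ => ‖G y q‖ₑ) q
      exact closure_minimal hsub hcl (Rat.denseRange_cast x)
    rw [this]
    refine Measurable.iSup fun q => ?_
    have : Measurable fun y => G y q := hG.comp (measurable_id.prodMk measurable_const)
    exact this.enorm
  · simp_rw [eLpNorm_eq_lintegral_rpow_enorm_toReal h0 hp']
    exact ((hG.enorm.pow_const p.toReal).lintegral_prod_right).pow_const _

theorem eLpNorm_const_mul_comp_sub {f : ℝ → ℝ≥0∞} (hf : Measurable f) (a : ℝ≥0∞) (z : ℝ)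
    {p : ℝ≥0∞} (hp : 1 ≤ p) (hp' : p ≠ ∞) :
    eLpNorm (fun x => a * f (x - z)) p volume = a * eLpNorm f p volume := by
  have h0 : p ≠ 0 := (zero_lt_one.trans_le hp).ne'
  have hpr : 0 < p.toReal := ENNReal.toReal_pos h0 hp'
  simp_rw [eLpNorm_eq_lintegral_rpow_enorm_toReal h0 hp', enorm_eq_self,
    ENNReal.mul_rpow_of_nonneg _ _ hpr.le]
  rw [lintegral_const_mul _ (by fun_prop), lintegral_sub_right_eq_self (fun x => f x ^ p.toReal) z,
    ENNReal.mul_rpow_of_nonneg _ _ (by positivity), ← ENNReal.rpow_mul,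
    mul_one_div_cancel hpr.ne', ENNReal.rpow_one]

/-- `L^p` bound for a superposition of convolutions. -/
theorem eLpNorm_le_of_enorm_le_lintegral {G : ℝ → ℝ → ℂ} (hG : Measurable (Function.uncurry G))
    (hc : ∀ y, Continuous (G y)) {k ρ : ℝ → ℝ≥0∞} (hk : Measurable k) (hρ : Measurable ρ)
    {w : ℝ → ℂ} (hw : ∀ x, ‖w x‖ₑ ≤ ∫⁻ y, ∫⁻ z, k y * ρ z * ‖G y (x - z)‖ₑ)
    {p : ℝ≥0∞} (hp : 1 ≤ p) :
    eLpNorm w p volume ≤ (∫⁻ z, ρ z) * ∫⁻ y, k y * eLpNorm (G y) p volume := by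
  have hN := measurable_eLpNorm_of_continuous hG hc hp
  have hfin : (∫⁻ z, ρ z) * ∫⁻ y, k y * eLpNorm (G y) p volume =
      ∫⁻ y, ∫⁻ z, k y * ρ z * eLpNorm (G y) p volume := by
    have hkN : Measurable fun y => k y * eLpNorm (G y) p volume := hk.mul hN
    rw [← lintegral_const_mul _ hkN]
    refine lintegral_congr fun y => ?_
    rw [lintegral_mul_const _ (hρ.const_mul _), lintegral_const_mul _ hρ]
    ring
  rw [hfin]
  rcases eq_or_ne p ∞ with rfl | hp'
  · rw [eLpNorm_exponent_top]
    refine essSup_le_of_ae_le _ (Filter.Eventually.of_forall fun x => (hw x).trans ?_)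
    refine lintegral_mono fun y => lintegral_mono fun z => ?_
    gcongr
    exact (hc y).enorm_le_eLpNorm_top _
  have hG3 : Measurable fun q : (ℝ × ℝ) × ℝ => k q.1.1 * ρ q.2 * ‖G q.1.1 (q.1.2 - q.2)‖ₑ := by
    have : Measurable fun q : (ℝ × ℝ) × ℝ => G q.1.1 (q.1.2 - q.2) :=
      hG.comp (g := fun r : ℝ × ℝ => G r.1 r.2)
        (f := fun q : (ℝ × ℝ) × ℝ => (q.1.1, q.1.2 - q.2)) (by fun_prop)
    fun_prop
  calc eLpNorm w p volume
      ≤ eLpNorm (fun x => ∫⁻ y, ∫⁻ z, k y * ρ z * ‖G y (x - z)‖ₑ) p volume :=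
        eLpNorm_mono_enorm fun x => by simpa using hw x
    _ ≤ ∫⁻ y, eLpNorm (fun x => ∫⁻ z, k y * ρ z * ‖G y (x - z)‖ₑ) p volume :=
        eLpNorm_lintegral_le _ _ hp hp'
          (F := fun y x => ∫⁻ z, k y * ρ z * ‖G y (x - z)‖ₑ) hG3.lintegral_prod_right
    _ ≤ ∫⁻ y, ∫⁻ z, eLpNorm (fun x => k y * ρ z * ‖G y (x - z)‖ₑ) p volume := by
        refine lintegral_mono fun y => ?_
        refine eLpNorm_lintegral_le _ _ hp hp' (F := fun z x => k y * ρ z * ‖G y (x - z)‖ₑ) ?_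
        exact hG3.comp (f := fun r : ℝ × ℝ => ((y, r.2), r.1)) (by fun_prop)
    _ = ∫⁻ y, ∫⁻ z, k y * ρ z * eLpNorm (G y) p volume := by
        refine lintegral_congr fun y => lintegral_congr fun z => ?_
        rw [eLpNorm_const_mul_comp_sub (f := fun x => ‖G y x‖ₑ) (hc y).enorm.measurable _ _ hp hp',
          eLpNorm_enorm]

/-- The inverse Fourier transform of a product is a convolution. -/
theorem fourierInv_mul_eq {H Γ : ℝ → ℂ} (hH : Continuous H) (hHi : Integrable H)
    (hk : Integrable (𝓕⁻ H)) (hΓ : Integrable Γ) (x : ℝ) :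
    𝓕⁻ (fun ξ => H ξ * Γ ξ) x = ∫ z, 𝓕⁻ H z * 𝓕⁻ Γ (x - z) := by
  have hF : Integrable (𝓕 H) := by
    have : 𝓕 H = fun w => 𝓕⁻ H (-w) := funext fun w => by
      rw [Real.fourierInv_eq_fourier_neg, neg_neg]
    rw [this]
    exact hk.comp_neg
  have hinv := hH.fourier_fourierInv_eq hHi hF
  set κ := 𝓕⁻ H
  have e1 : ∀ ξ z : ℝ, Complex.exp (((2 * π * (ξ * (x - z)) : ℝ) : ℂ) * Complex.I) =
      Complex.exp (((2 * π * (ξ * x) : ℝ) : ℂ) * Complex.I) *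
        Complex.exp (((-2 * π * (z * ξ) : ℝ) : ℂ) * Complex.I) := fun ξ z => by
    rw [← Complex.exp_add]
    congr 1
    push_cast
    ring
  have inner_eq : ∀ a b : ℝ, inner ℝ a b = a * b := fun a b => by
    simp [mul_comm]
  calc 𝓕⁻ (fun ξ => H ξ * Γ ξ) x
      = ∫ ξ, ∫ z, Complex.exp (((2 * π * (ξ * (x - z)) : ℝ) : ℂ) * Complex.I) * (Γ ξ * κ z) := by
        rw [Real.fourierInv_eq']
        refine integral_congr_ae (Filter.Eventually.of_forall fun ξ => ?_)
        beta_reduce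
        rw [← hinv, Real.fourier_eq', inner_eq]
        simp_rw [inner_eq, e1, smul_eq_mul]
        rw [← integral_mul_const, ← integral_const_mul]
        congr 1; ext z
        ring
    _ = ∫ z, ∫ ξ, Complex.exp (((2 * π * (ξ * (x - z)) : ℝ) : ℂ) * Complex.I) * (Γ ξ * κ z) := by
        refine integral_integral_swap ?_
        refine (hΓ.mul_prod hk).bdd_mul (c := 1) ?_ (Filter.Eventually.of_forall fun q => ?_)
        · exact Continuous.aestronglyMeasurable (by fun_prop)
        · rw [Complex.norm_exp_ofReal_mul_I]
    _ = ∫ z, κ z * 𝓕⁻ Γ (x - z) := by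
        congr 1; ext z
        rw [Real.fourierInv_eq', ← integral_const_mul]
        congr 1; ext ξ
        rw [inner_eq, smul_eq_mul]
        ring

section PartialFourier

variable {g : ℝ × ℝ → ℂ}

theorem norm_pFT_le (y ξ : ℝ) : ‖pFT g y ξ‖ ≤ ∫ x, ‖g (y, x)‖ :=
  VectorFourier.norm_fourierIntegral_le_integral_norm _ _ _ _ _

theorem stronglyMeasurable_pFT (hg : Continuous g) :
    StronglyMeasurable fun q : ℝ × ℝ => pFT g q.1 q.2 := by
  have : (fun q : ℝ × ℝ => pFT g q.1 q.2) = fun q : ℝ × ℝ =>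
      ∫ x, Complex.exp (((-2 * π * x * q.2 : ℝ) : ℂ) * Complex.I) • g (q.1, x) := by
    funext q
    rw [pFT, Real.fourier_real_eq_integral_exp_smul]
  rw [this]
  refine StronglyMeasurable.integral_prod_right (f := fun (q : ℝ × ℝ) (x : ℝ) =>
    Complex.exp (((-2 * π * x * q.2 : ℝ) : ℂ) * Complex.I) • g (q.1, x)) ?_
  refine Continuous.stronglyMeasurable ?_
  simp only [Function.uncurry_def]
  fun_prop

theorem integrable_cutoff_mul_pFT (hg : Continuous g) {φ : ℝ → ℂ} (hφ : Integrable φ) (y : ℝ) :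
    Integrable fun ξ => φ ξ * pFT g y ξ := by
  refine hφ.mul_bdd (c := ∫ x, ‖g (y, x)‖) ?_ (Filter.Eventually.of_forall fun ξ => norm_pFT_le y ξ)
  exact ((stronglyMeasurable_pFT hg).comp_measurable
    (measurable_const.prodMk measurable_id : Measurable fun ξ : ℝ => (y, ξ))).aestronglyMeasurable

theorem continuous_fourierInv {f : ℝ → ℂ} (hf : Integrable f) : Continuous (𝓕⁻ f) := by
  have : 𝓕⁻ f = fun x => ∫ ξ, Complex.exp (((2 * π * inner ℝ ξ x : ℝ) : ℂ) * Complex.I) • f ξ :=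
    funext fun x => Real.fourierInv_eq' f x
  rw [this]
  refine continuous_of_dominated (fun x => ?_) (fun x => ?_) hf.norm ?_
  · have : Continuous fun ξ : ℝ => Complex.exp (((2 * π * inner ℝ ξ x : ℝ) : ℂ) * Complex.I) := by
      fun_prop
    exact this.aestronglyMeasurable.smul hf.1
  · refine Filter.Eventually.of_forall fun ξ => ?_
    rw [norm_smul, Complex.norm_exp_ofReal_mul_I, one_mul]
  · refine Filter.Eventually.of_forall fun ξ => ?_
    fun_prop

theorem measurable_fourierInv_cutoff_mul_pFT (hg : Continuous g) {φ : ℝ → ℂ}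
    (hφ : Measurable φ) :
    Measurable (Function.uncurry fun y x => 𝓕⁻ (fun ξ => φ ξ * pFT g y ξ) x) := by
  have : (Function.uncurry fun y x => 𝓕⁻ (fun ξ => φ ξ * pFT g y ξ) x) = fun q : ℝ × ℝ =>
      ∫ ξ, Complex.exp (((2 * π * inner ℝ ξ q.2 : ℝ) : ℂ) * Complex.I) • (φ ξ * pFT g q.1 ξ) := by
    funext q
    simp only [Function.uncurry_def, Real.fourierInv_eq']
  rw [this]
  refine (StronglyMeasurable.integral_prod_right (f := fun (q : ℝ × ℝ) (ξ : ℝ) =>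
    Complex.exp (((2 * π * inner ℝ ξ q.2 : ℝ) : ℂ) * Complex.I) • (φ ξ * pFT g q.1 ξ)) ?_).measurable
  have hp : Measurable fun r : (ℝ × ℝ) × ℝ => pFT g r.1.1 r.2 :=
    Measurable.comp (g := fun q : ℝ × ℝ => pFT g q.1 q.2)
      (f := fun r : (ℝ × ℝ) × ℝ => (r.1.1, r.2)) (stronglyMeasurable_pFT hg).measurable
      (by fun_prop)
  refine Measurable.stronglyMeasurable ?_
  simp only [Function.uncurry_def]
  have he : Measurable fun r : (ℝ × ℝ) × ℝ =>
      Complex.exp (((2 * π * inner ℝ r.2 r.1.2 : ℝ) : ℂ) * Complex.I) :=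
    Continuous.measurable (by fun_prop)
  have hφ2 : Measurable fun r : (ℝ × ℝ) × ℝ => φ r.2 := hφ.comp measurable_snd
  exact he.smul (hφ2.mul hp)

end PartialFourier

theorem lamM_nonpos {α : ℝ} (ξ : ℝ) : lamM α ξ ≤ 0 := by
  have : α ≤ √(α ^ 2 + 4 * ξ ^ 2) := Real.le_sqrt_of_sq_le (by nlinarith [sq_nonneg ξ])
  rw [lamM]; linarith

theorem lamP_nonneg {α : ℝ} (hα : 0 < α) (ξ : ℝ) : 0 ≤ lamP α ξ := by
  have := Real.sqrt_nonneg (α ^ 2 + 4 * ξ ^ 2)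
  rw [lamP]; linarith

theorem decayFactor_nonneg (α ξ t : ℝ) : 0 ≤ decayFactor α ξ t := by
  rw [decayFactor]; split_ifs <;> positivity

theorem decayFactor_le_one {α : ℝ} (hα : 0 < α) (ξ t : ℝ) : decayFactor α ξ t ≤ 1 := by
  rw [decayFactor]
  split_ifs with h
  · exact Real.exp_le_one_iff.2 (mul_nonpos_of_nonpos_of_nonneg (lamM_nonpos _) h)
  · exact Real.exp_le_one_iff.2 (mul_nonpos_of_nonneg_of_nonpos (lamP_nonneg hα _) (by linarith))

theorem measurable_decayFactor (α : ℝ) : Measurable fun q : ℝ × ℝ => decayFactor α q.1 q.2 := by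
  refine Measurable.ite (measurableSet_le measurable_const measurable_snd) ?_ ?_
  · unfold lamM; exact Continuous.measurable (by fun_prop)
  · unfold lamP; exact Continuous.measurable (by fun_prop)

theorem lintegral_exp_neg_mul_abs {b : ℝ} (hb : 0 < b) :
    ∫⁻ t : ℝ, ENNReal.ofReal (rexp (-(b * |t|))) = ENNReal.ofReal (2 / b) := by
  have hval : ∫ t : ℝ, rexp (-(b * |t|)) = 2 / b := by
    rw [integral_comp_abs (f := fun t : ℝ => rexp (-(b * t)))]
    have := integral_exp_mul_Ioi (a := -b) (by linarith) 0
    simp only [neg_mul] at this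
    rw [this]
    simp
    ring
  have hint : Integrable fun t : ℝ => rexp (-(b * |t|)) :=
    not_imp_comm.1 integral_undef (by rw [hval]; positivity)
  rw [← ofReal_integral_eq_lintegral_ofReal hint
    (Filter.Eventually.of_forall fun t => (Real.exp_pos _).le), hval]

theorem integrable_poissonKernel {L : ℝ} (hL : 0 < L) :
    Integrable fun z : ℝ => L * (1 + (L * z) ^ 2)⁻¹ :=
  (integrable_inv_one_add_sq.comp_mul_left' hL.ne').const_mul L

theorem lintegral_poissonKernel {L : ℝ} (hL : 0 < L) :
    ∫⁻ z : ℝ, ENNReal.ofReal (L * (1 + (L * z) ^ 2)⁻¹) = ENNReal.ofReal π := by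
  rw [← ofReal_integral_eq_lintegral_ofReal (integrable_poissonKernel hL)
    (Filter.Eventually.of_forall fun z => by positivity), integral_const_mul,
    Measure.integral_comp_mul_left (fun z : ℝ => (1 + z ^ 2)⁻¹), integral_univ_inv_one_add_sq,
    smul_eq_mul, abs_of_pos (inv_pos.2 hL), mul_inv_cancel_left₀ hL.ne']

theorem enorm_fourierInv_mul_le {H : ℝ → ℝ} {Γ : ℝ → ℂ} {L M R : ℝ} (hL : 0 < L) (hM : 0 ≤ M)
    (hH : Continuous H) (hs : ∀ ξ, R < |ξ| → H ξ = 0)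
    (hk : ∀ z, ‖𝓕⁻ (fun ξ => (H ξ : ℂ)) z‖ ≤ M * (L * (1 + (L * z) ^ 2)⁻¹))
    (hΓ : Integrable Γ) (x : ℝ) :
    ‖𝓕⁻ (fun ξ => (H ξ : ℂ) * Γ ξ) x‖ₑ ≤
      ∫⁻ z, ENNReal.ofReal M * ENNReal.ofReal (L * (1 + (L * z) ^ 2)⁻¹) * ‖𝓕⁻ Γ (x - z)‖ₑ := by
  have hHc : Continuous fun ξ => (H ξ : ℂ) := by fun_prop
  have hHi : Integrable fun ξ => (H ξ : ℂ) := by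
    refine hHc.integrable_of_hasCompactSupport
      (HasCompactSupport.intro (isCompact_closedBall (0 : ℝ) R) fun ξ hξ => ?_)
    rw [hs ξ (by simpa using hξ), Complex.ofReal_zero]
  have hki : Integrable (𝓕⁻ fun ξ => (H ξ : ℂ)) :=
    ((integrable_poissonKernel hL).const_mul M).mono'
      (continuous_fourierInv hHi).aestronglyMeasurable (Filter.Eventually.of_forall hk)
  rw [fourierInv_mul_eq hHc hHi hki hΓ]
  refine (enorm_integral_le_lintegral_enorm _).trans (lintegral_mono fun z => ?_)
  rw [enorm_mul, ← ENNReal.ofReal_mul hM, ← ofReal_norm (𝓕⁻ (fun ξ => (H ξ : ℂ)) z)]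
  gcongr
  exact hk z

section Block

variable {g : ℝ × ℝ → ℂ} {α : ℝ}

theorem integrable_decayFactor_mul_pFT (hg : Continuous g) (hgi : Integrable g) (hα : 0 < α)
    {A : ℝ → ℂ} (hA : Integrable A) (x : ℝ) :
    Integrable fun q : ℝ × ℝ => A q.1 * (decayFactor α q.1 (x - q.2) * pFT g q.2 q.1) := by
  have hI : Integrable fun y => ∫ z, ‖g (y, z)‖ := hgi.integral_norm_prod_left
  refine (hA.norm.mul_prod hI).mono' ?_ (Filter.Eventually.of_forall fun q => ?_)
  · have hd : Measurable fun q : ℝ × ℝ => decayFactor α q.1 (x - q.2) :=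
      Measurable.comp (g := fun q : ℝ × ℝ => decayFactor α q.1 q.2)
        (f := fun q : ℝ × ℝ => (q.1, x - q.2)) (measurable_decayFactor α) (by fun_prop)
    have hp : Measurable fun q : ℝ × ℝ => pFT g q.2 q.1 :=
      Measurable.comp (g := fun q : ℝ × ℝ => pFT g q.1 q.2)
        (f := fun q : ℝ × ℝ => (q.2, q.1)) (stronglyMeasurable_pFT hg).measurable (by fun_prop)
    exact hA.1.comp_fst.mul ((Complex.measurable_ofReal.comp hd).mul hp).aestronglyMeasurable
  · rw [norm_mul, norm_mul, Complex.norm_real, Real.norm_of_nonneg (decayFactor_nonneg _ _ _)]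
    have h1 := decayFactor_le_one hα q.1 (x - q.2)
    have h2 := norm_pFT_le (g := g) q.2 q.1
    have h3 := decayFactor_nonneg α q.1 (x - q.2)
    gcongr
    calc _ ≤ 1 * ‖pFT g q.2 q.1‖ := by gcongr
      _ ≤ _ := by rwa [one_mul]

theorem setIntegral_Iic_add_Ici_eq (hg : Continuous g) (hgi : Integrable g) (hα : 0 < α)
    (x ξ : ℝ) :
    (∫ y in Set.Iic x, (rexp (lamM α (2 * π * ξ) * (x - y)) : ℂ) * pFT g y ξ) +
      ∫ y in Set.Ici x, (rexp (lamP α (2 * π * ξ) * (x - y)) : ℂ) * pFT g y ξ =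
    ∫ y, decayFactor α ξ (x - y) * pFT g y ξ := by
  have hI : Integrable fun y => ∫ z, ‖g (y, z)‖ := hgi.integral_norm_prod_left
  have hi : Integrable fun y => (decayFactor α ξ (x - y) : ℂ) * pFT g y ξ := by
    refine hI.mono' ?_ (Filter.Eventually.of_forall fun y => ?_)
    · have hd : Measurable fun y : ℝ => decayFactor α ξ (x - y) :=
        Measurable.comp (g := fun q : ℝ × ℝ => decayFactor α q.1 q.2)
          (f := fun y : ℝ => (ξ, x - y)) (measurable_decayFactor α) (by fun_prop)
      have hp : Measurable fun y : ℝ => pFT g y ξ :=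
        Measurable.comp (g := fun q : ℝ × ℝ => pFT g q.1 q.2)
          (f := fun y : ℝ => (y, ξ)) (stronglyMeasurable_pFT hg).measurable (by fun_prop)
      exact ((Complex.measurable_ofReal.comp hd).mul hp).aestronglyMeasurable
    · rw [norm_mul, Complex.norm_real, Real.norm_of_nonneg (decayFactor_nonneg _ _ _)]
      exact (mul_le_of_le_one_left (norm_nonneg _) (decayFactor_le_one hα _ _)).trans
        (norm_pFT_le y ξ)
  rw [integral_Ici_eq_integral_Ioi,
    ← intervalIntegral.integral_Iic_add_Ioi hi.integrableOn hi.integrableOn (b := x)]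
  congr 1
  · refine setIntegral_congr_fun measurableSet_Iic fun y hy => ?_
    have : 0 ≤ x - y := sub_nonneg.2 hy
    simp only [decayFactor, if_pos this]
  · refine setIntegral_congr_fun measurableSet_Ioi fun y hy => ?_
    have : ¬ 0 ≤ x - y := not_le.2 (sub_neg.2 hy)
    simp only [decayFactor, if_neg this]

variable {φ₀ : ℝ → ℝ}

theorem Wop_eq_neg_integral (hg : Continuous g) (hgi : Integrable g) (hα : 0 < α) (j : ℤ)
    (hA : Integrable fun ξ : ℝ => (φ₀ ((2:ℝ) ^ (-j) * ξ) : ℂ) *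
      (((α ^ 2 + 16 * π ^ 2 * ξ ^ 2) ^ (-(1:ℝ)/2) : ℝ) : ℂ) *
        (2 * (π : ℂ) * Complex.I * (ξ : ℂ))) (x₁ x₂ : ℝ) :
    Wop φ₀ α j g x₁ x₂ = -∫ y, 𝓕⁻ (fun ξ : ℝ => (φ₀ ((2:ℝ) ^ (-j) * ξ) : ℂ) *
      (((α ^ 2 + 16 * π ^ 2 * ξ ^ 2) ^ (-(1:ℝ)/2) : ℝ) : ℂ) *
        (2 * (π : ℂ) * Complex.I * (ξ : ℂ)) *
          (decayFactor α ξ (x₁ - y) * pFT g y ξ)) x₂ := by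
  rw [Wop, Real.fourierInv_eq']
  simp_rw [Real.fourierInv_eq', setIntegral_Iic_add_Ici_eq hg hgi hα, ← integral_const_mul,
    ← integral_smul]
  rw [integral_integral_swap]
  refine ((integrable_decayFactor_mul_pFT hg hgi hα hA x₁).bdd_mul (c := 1)
    (f := fun q : ℝ × ℝ => Complex.exp (((2 * π * inner ℝ q.1 x₂ : ℝ) : ℂ) * Complex.I)) ?_
    (Filter.Eventually.of_forall fun q => ?_))
  · exact Continuous.aestronglyMeasurable (by fun_prop)
  · rw [Complex.norm_exp_ofReal_mul_I]

end Block

theorem integrable_of_support_subset_annulus {φ₀ : ℝ → ℝ} (hφ : Continuous φ₀)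
    (hφ_supp : Function.support φ₀ ⊆ {ξ : ℝ | 1/2 ≤ |ξ| ∧ |ξ| ≤ 2}) {r : ℝ} (hr : 0 < r)
    {a : ℝ → ℂ} (ha : Continuous a) : Integrable fun ξ => (φ₀ (r * ξ) : ℂ) * a ξ := by
  refine Continuous.integrable_of_hasCompactSupport (by fun_prop)
    (HasCompactSupport.intro (isCompact_closedBall (0 : ℝ) (2 / r)) fun ξ hξ => ?_)
  have : φ₀ (r * ξ) = 0 := by
    by_contra h
    have h2 := (hφ_supp (Function.mem_support.2 h)).2
    rw [abs_mul, abs_of_pos hr, ← le_div_iff₀' hr] at h2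
    exact hξ (by simpa using h2)
  rw [this, Complex.ofReal_zero, zero_mul]

theorem fourierInv_const_mul (a : ℂ) (f : ℝ → ℂ) (x : ℝ) :
    𝓕⁻ (fun ξ => a * f ξ) x = a * 𝓕⁻ f x := by
  rw [Real.fourierInv_eq', Real.fourierInv_eq', ← integral_const_mul]
  congr 1
  ext ξ
  simp only [smul_eq_mul]
  ring

/-- Pointwise domination of `Wop` by a convolution of the Littlewood–Paley block with an
exponentially decaying kernel in the first variable and a Poisson kernel in the second one. -/
theorem exists_enorm_Wop_le {φ₀ : ℝ → ℝ} (hφ : Continuous φ₀)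
    (hφ_supp : Function.support φ₀ ⊆ {ξ : ℝ | 1/2 ≤ |ξ| ∧ |ξ| ≤ 2}) :
    ∃ C c : ℝ, 0 < C ∧ 0 < c ∧ ∀ α : ℝ, 0 < α → ∀ g : ℝ × ℝ → ℂ, Continuous g → Integrable g →
      ∀ (j : ℤ) (x₁ x₂ : ℝ), ‖Wop φ₀ α j g x₁ x₂‖ₑ ≤ ∫⁻ y, ∫⁻ z,
        ENNReal.ofReal (C * (max 1 (α / (2:ℝ) ^ j))⁻¹ *
          rexp (-(c * ((2:ℝ) ^ j * |x₁ - y| / max 1 (α / (2:ℝ) ^ j))))) *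
        ENNReal.ofReal ((2:ℝ) ^ j * (1 + ((2:ℝ) ^ j * z) ^ 2)⁻¹) *
        ‖LPblock φ₀ j g y (x₂ - z)‖ₑ := by
  obtain ⟨C, c, hC, hc, hmul⟩ := exists_multiplier
  refine ⟨2 * π * C, c, by positivity, hc, fun α hα g hg hgi j x₁ x₂ => ?_⟩
  have hL : (0:ℝ) < 2 ^ j := by positivity
  have hj : (2:ℝ) ^ (-j) = ((2:ℝ) ^ j)⁻¹ := zpow_neg _ _
  have hac : Continuous fun ξ : ℝ => (((α ^ 2 + 16 * π ^ 2 * ξ ^ 2) ^ (-(1:ℝ)/2) : ℝ) : ℂ) *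
      (2 * (π : ℂ) * Complex.I * (ξ : ℂ)) := by
    have : Continuous fun ξ : ℝ => (α ^ 2 + 16 * π ^ 2 * ξ ^ 2) ^ (-(1:ℝ)/2) :=
      Continuous.rpow_const (by fun_prop) fun ξ => Or.inl (by positivity)
    fun_prop
  have hA := integrable_of_support_subset_annulus hφ hφ_supp (r := (2:ℝ) ^ (-j)) (by positivity) hac
  simp_rw [← mul_assoc (φ₀ _ : ℂ)] at hA
  have hφi : Integrable fun ξ : ℝ => (φ₀ ((2:ℝ) ^ (-j) * ξ) : ℂ) := by
    simpa using integrable_of_support_subset_annulus hφ hφ_supp (r := (2:ℝ) ^ (-j))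
      (by positivity) (continuous_const (y := (1 : ℂ)))
  rw [Wop_eq_neg_integral hg hgi hα j hA, enorm_neg]
  refine (enorm_integral_le_lintegral_enorm _).trans (lintegral_mono fun y => ?_)
  obtain ⟨H, hHc, hHs, hHeq, hHb⟩ := hmul α (2 ^ j) hα hL (x₁ - y)
  have hfun : (fun ξ : ℝ => (φ₀ ((2:ℝ) ^ (-j) * ξ) : ℂ) *
      (((α ^ 2 + 16 * π ^ 2 * ξ ^ 2) ^ (-(1:ℝ)/2) : ℝ) : ℂ) *
        (2 * (π : ℂ) * Complex.I * (ξ : ℂ)) * (decayFactor α ξ (x₁ - y) * pFT g y ξ)) =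
      fun ξ => (2 * (π : ℂ) * Complex.I) *
        ((H ξ : ℂ) * ((φ₀ ((2:ℝ) ^ (-j) * ξ) : ℂ) * pFT g y ξ)) := by
    funext ξ
    by_cases h : φ₀ ((2:ℝ) ^ (-j) * ξ) = 0
    · rw [h]
      simp
    · have hs := hφ_supp (Function.mem_support.2 h)
      rw [hj] at hs
      rw [hHeq ξ hs.1 hs.2]
      push_cast
      ring
  rw [hfun, fourierInv_const_mul, enorm_mul]
  have hπ : ‖(2 * (π : ℂ) * Complex.I)‖ₑ = ENNReal.ofReal (2 * π) := by
    rw [← ofReal_norm]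
    simp [abs_of_pos Real.pi_pos]
  have hM : 0 ≤ C * (max 1 (α / (2:ℝ) ^ j))⁻¹ *
      rexp (-(c * ((2:ℝ) ^ j * |x₁ - y| / max 1 (α / (2:ℝ) ^ j)))) := by positivity
  have hbound := enorm_fourierInv_mul_le hL hM hHc hHs hHb
    (integrable_cutoff_mul_pFT hg hφi y) x₂
  rw [hπ]
  refine (mul_le_mul_right hbound _).trans ?_
  rw [← lintegral_const_mul' _ _ ENNReal.ofReal_ne_top]
  refine lintegral_mono fun z => le_of_eq ?_
  rw [← mul_assoc, ← mul_assoc, ← ENNReal.ofReal_mul (by positivity), LPblock]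
  ring_nf

theorem rpow_mul_rpow_le {C b L μ a : ℝ} (hC : 0 < C) (hb : 0 < b) (hL : 0 < L) (hμ : 0 < μ)
    (ha0 : 0 ≤ a) (ha1 : a ≤ 1) :
    (C * b * L⁻¹) ^ (1 - a) * (C * μ⁻¹) ^ a ≤ C * max 1 b * L ^ (-(1 - a)) * μ ^ (-a) := by
  have hm : b ^ (1 - a) ≤ max 1 b :=
    calc b ^ (1 - a) ≤ max 1 b ^ (1 - a) :=
          Real.rpow_le_rpow hb.le (le_max_right _ _) (by linarith)
      _ ≤ max 1 b ^ (1 : ℝ) :=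
          Real.rpow_le_rpow_of_exponent_le (le_max_left _ _) (by linarith)
      _ = max 1 b := Real.rpow_one _
  have hCa : C ^ (1 - a) * C ^ a = C := by
    rw [← Real.rpow_add hC, sub_add_cancel, Real.rpow_one]
  rw [Real.mul_rpow (by positivity) (by positivity), Real.mul_rpow (by positivity) (by positivity),
    Real.mul_rpow (by positivity) (by positivity), Real.inv_rpow hL.le, Real.inv_rpow hμ.le,
    ← Real.rpow_neg hL.le, ← Real.rpow_neg hμ.le]
  calc C ^ (1 - a) * b ^ (1 - a) * L ^ (-(1 - a)) * (C ^ a * μ ^ (-a))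
      = (C ^ (1 - a) * C ^ a) * b ^ (1 - a) * L ^ (-(1 - a)) * μ ^ (-a) := by ring
    _ ≤ C * max 1 b * L ^ (-(1 - a)) * μ ^ (-a) := by
      rw [hCa]
      gcongr

/-- The part of the estimate that does not depend on the relative size of `2 ^ j` and `α`. -/
theorem exists_mixedNorm_Wop_le {φ₀ : ℝ → ℝ} (hφ : Continuous φ₀)
    (hφ_supp : Function.support φ₀ ⊆ {ξ : ℝ | 1/2 ≤ |ξ| ∧ |ξ| ≤ 2}) :
    ∃ C : ℝ, 0 < C ∧ ∀ α : ℝ, 0 < α → ∀ g : ℝ × ℝ → ℂ, Continuous g → Integrable g →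
      ∀ (j : ℤ) (p₁ p₂ p₃ : ℝ≥0∞), 1 ≤ p₁ → 1 ≤ p₂ → 1 ≤ p₃ → p₃ ≤ p₁ →
        mixedNorm p₁ p₂ (Wop φ₀ α j g) ≤
          ENNReal.ofReal (C * ((2:ℝ) ^ j) ^ (-1 + (1 / p₃).toReal - (1 / p₁).toReal) *
            max 1 (α / (2:ℝ) ^ j) ^ ((1 / p₁).toReal - (1 / p₃).toReal)) *
          mixedNorm p₃ p₂ (LPblock φ₀ j g) := by
  obtain ⟨C, c, hC, hc, hW⟩ := exists_enorm_Wop_le hφ hφ_supp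
  refine ⟨π * C * max 1 (2 / c), by positivity, fun α hα g hg hgi j p₁ p₂ p₃ h₁ h₂ h₃ h₃₁ => ?_⟩
  have hL : (0:ℝ) < 2 ^ j := by positivity
  replace hW := hW α hα g hg hgi j
  set L : ℝ := 2 ^ j with hLdef
  set μ := max 1 (α / L) with hμ
  have hμ0 : 0 < μ := by positivity
  set a := (1 / p₃).toReal - (1 / p₁).toReal with ha
  have ha0 : 0 ≤ a := by
    refine sub_nonneg.2 (ENNReal.toReal_mono ?_ ?_)
    · simpa using (zero_lt_one.trans_le h₃).ne'
    · simpa using h₃₁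
  have ha1 : a ≤ 1 := by
    have : (1 / p₃).toReal ≤ (1 : ℝ≥0∞).toReal :=
      ENNReal.toReal_mono ENNReal.one_ne_top (by simpa using h₃)
    have h0 : 0 ≤ (1 / p₁).toReal := ENNReal.toReal_nonneg
    rw [ENNReal.toReal_one] at this
    linarith
  let k : ℝ → ℝ≥0∞ := fun t => ENNReal.ofReal (C * μ⁻¹ * rexp (-(c * (L * |t| / μ))))
  have hk : Measurable k := by
    refine ENNReal.measurable_ofReal.comp (Continuous.measurable ?_)
    fun_prop
  have hkS : ∀ t, k t ≤ ENNReal.ofReal (C * μ⁻¹) := fun t => by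
    refine ENNReal.ofReal_le_ofReal (mul_le_of_le_one_right (by positivity) ?_)
    exact Real.exp_le_one_iff.2 (neg_nonpos.2 (by positivity))
  have hkT : ∫⁻ t, k t ≤ ENNReal.ofReal (C * (2 / c) * L⁻¹) := by
    refine le_of_eq ?_
    simp only [k]
    simp_rw [ENNReal.ofReal_mul (p := C * μ⁻¹) (by positivity),
      fun t : ℝ => show c * (L * |t| / μ) = c * L / μ * |t| by ring]
    rw [lintegral_const_mul _ (by fun_prop), lintegral_exp_neg_mul_abs (by positivity),
      ← ENNReal.ofReal_mul (by positivity)]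
    congr 1
    field_simp
  have hφi : Integrable fun ξ : ℝ => (φ₀ ((2:ℝ) ^ (-j) * ξ) : ℂ) := by
    simpa using integrable_of_support_subset_annulus hφ hφ_supp (r := (2:ℝ) ^ (-j))
      (by positivity) (continuous_const (y := (1 : ℂ)))
  have hGm : Measurable (Function.uncurry (LPblock φ₀ j g)) :=
    measurable_fourierInv_cutoff_mul_pFT hg (φ := fun ξ : ℝ => (φ₀ ((2:ℝ) ^ (-j) * ξ) : ℂ))
      (Continuous.measurable (by fun_prop))
  have hGc : ∀ y, Continuous (LPblock φ₀ j g y) := fun y =>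
    continuous_fourierInv (integrable_cutoff_mul_pFT hg hφi y)
  have hpt : ∀ x₁, eLpNorm (Wop φ₀ α j g x₁) p₂ volume ≤
      ENNReal.ofReal π * ∫⁻ y, k (x₁ - y) * eLpNorm (LPblock φ₀ j g y) p₂ volume := fun x₁ => by
    rw [← lintegral_poissonKernel hL]
    exact eLpNorm_le_of_enorm_le_lintegral hGm hGc (k := fun y => k (x₁ - y)) (by fun_prop)
      (by fun_prop) (hW x₁) h₂
  have hN := measurable_eLpNorm_of_continuous hGm hGc h₂
  rw [mixedNorm_eq_eLpNorm h₁, mixedNorm_eq_eLpNorm h₃]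
  have hconv := eLpNorm_lconvolution_le hk hN hkS hkT h₃ h₃₁
  calc eLpNorm (fun x => eLpNorm (Wop φ₀ α j g x) p₂ volume) p₁ volume
      ≤ ENNReal.ofReal π * eLpNorm (fun x => ∫⁻ y, k (x - y) *
          eLpNorm (LPblock φ₀ j g y) p₂ volume) p₁ volume :=
        eLpNorm_le_mul_eLpNorm_of_ae_le_mul' (c := Real.toNNReal π)
          (Filter.Eventually.of_forall hpt) _
    _ ≤ ENNReal.ofReal π * (ENNReal.ofReal (C * (2 / c) * L⁻¹) ^ (1 - a) *
          ENNReal.ofReal (C * μ⁻¹) ^ a *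
          eLpNorm (fun y => eLpNorm (LPblock φ₀ j g y) p₂ volume) p₃ volume) := by
        rw [ha, ← sub_add]
        gcongr
    _ ≤ _ := by
        rw [ENNReal.ofReal_rpow_of_nonneg (by positivity) (by linarith),
          ENNReal.ofReal_rpow_of_nonneg (by positivity) ha0,
          ← ENNReal.ofReal_mul (by positivity), ← mul_assoc, ← ENNReal.ofReal_mul (by positivity)]
        refine mul_le_mul_left (ENNReal.ofReal_le_ofReal ?_) _
        have e₁ : -1 + (1 / p₃).toReal - (1 / p₁).toReal = -(1 - a) := by rw [ha]; ring
        have e₂ : (1 / p₁).toReal - (1 / p₃).toReal = -a := by rw [ha]; ring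
        rw [e₁, e₂, mul_assoc π C, mul_assoc π, mul_assoc π]
        exact mul_le_mul_of_nonneg_left
          (rpow_mul_rpow_le hC (by positivity) hL hμ0 ha0 ha1) Real.pi_pos.le

/-- mixed-norm estimates for the block of `𝒟^{(0)}[∂_{x₂}g]`. -/
theorem statement15 (φ₀ : ℝ → ℝ)
    (hφ_smooth : ContDiff ℝ (⊤ : ℕ∞) φ₀)
    (hφ_range : ∀ ξ : ℝ, 0 ≤ φ₀ ξ ∧ φ₀ ξ ≤ 1)
    (hφ_supp : Function.support φ₀ ⊆ {ξ : ℝ | 1/2 ≤ |ξ| ∧ |ξ| ≤ 2})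
    (hφ_sum : ∀ ξ : ℝ, ξ ≠ 0 → HasSum (fun j : ℤ => φ₀ ((2:ℝ) ^ (-j) * ξ)) 1) :
    ∃ C : ℝ, 0 < C ∧
      ∀ (α : ℝ), 0 < α → ∀ (g : 𝓢(ℝ × ℝ, ℂ)) (j : ℤ) (p₁ p₂ p₃ : ℝ≥0∞),
        1 ≤ p₁ → 1 ≤ p₂ → 1 ≤ p₃ → p₃ ≤ p₁ →
        ((2:ℝ) ^ j > α →
          mixedNorm p₁ p₂ (Wop φ₀ α j ⇑g)
            ≤ ENNReal.ofReal
                (C * (2:ℝ) ^ ((-1 + (1/p₃).toReal - (1/p₁).toReal) * (j : ℝ))) *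
              mixedNorm p₃ p₂ (LPblock φ₀ j ⇑g)) ∧
        ((2:ℝ) ^ j ≤ α →
          mixedNorm p₁ p₂ (Wop φ₀ α j ⇑g)
            ≤ ENNReal.ofReal
                (C * α ^ ((1/p₁).toReal - (1/p₃).toReal) *
                  (2:ℝ) ^ ((-1 + 2 * (1/p₃).toReal - 2 * (1/p₁).toReal) * (j : ℝ))) *
              mixedNorm p₃ p₂ (LPblock φ₀ j ⇑g)) := by
  obtain ⟨C, hC, h⟩ := exists_mixedNorm_Wop_le hφ_smooth.continuous hφ_supp
  refine ⟨C, hC, fun α hα g j p₁ p₂ p₃ h₁ h₂ h₃ h₃₁ => ?_⟩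
  have hL : (0:ℝ) < 2 ^ j := by positivity
  have hpow : ∀ s : ℝ, (2:ℝ) ^ (s * (j : ℝ)) = ((2:ℝ) ^ j) ^ s := fun s => by
    rw [mul_comm, Real.rpow_mul two_pos.le, Real.rpow_intCast]
  have hmain := h α hα g g.continuous g.integrable j p₁ p₂ p₃ h₁ h₂ h₃ h₃₁
  simp only [hpow]
  refine ⟨fun hj => ?_, fun hj => ?_⟩
  · rwa [max_eq_left ((div_le_one hL).2 hj.le), Real.one_rpow, mul_one] at hmain
  · rw [max_eq_right ((one_le_div hL).2 hj), Real.div_rpow hα.le hL.le] at hmain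
    convert hmain using 3
    rw [mul_assoc, mul_assoc, mul_div_left_comm, ← Real.rpow_sub hL]
    ring_nf
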